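/- arXiv:2507.15665 — 3 statements merged into one kernel-verified Lean document; each statement's English description precedes it below -/
import Mathlib

section
/- For every positive integer n, the determinant of the n×n matrix whose (i,j)-entry (0 ≤ i,j ≤ n−1) is 2^{i+1}·binom(4j+i+2, 4j+2) + binom(4j−i, 4j+2) equals the product over i = 1 to n of Γ(6i−1)·Γ((i+2)/4) / (2·(2i−1)·Γ(5i−1)·Γ((5i−2)/4)). -/
open scoped BigOperators

/-- Generalized binomial coefficient: `binom α p = α(α−1)⋯(α−p+1)/p!`. -/
noncomputable def binom (α : ℤ) (p : ℕ) : ℝ :=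
  (∏ k ∈ Finset.range p, ((α : ℝ) - (k : ℝ))) / (p.factorial : ℝ)

namespace OctahedralDet

open PowerSeries in
/-- Logarithmic derivative of an integer power of a unit power series. -/
theorem derivative_unit_zpow (u : ℂ⟦X⟧ˣ) (k : ℤ) :
    d⁄dX ℂ ((u ^ k : ℂ⟦X⟧ˣ) : ℂ⟦X⟧) * u = (k : ℂ⟦X⟧) * ((u ^ k : ℂ⟦X⟧ˣ) : ℂ⟦X⟧) * d⁄dX ℂ (u : ℂ⟦X⟧) := by
  have step : ∀ j : ℤ, ((u ^ (j + 1) : ℂ⟦X⟧ˣ) : ℂ⟦X⟧) = ((u ^ j : ℂ⟦X⟧ˣ) : ℂ⟦X⟧) * u := fun j => by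
    rw [zpow_add_one, Units.val_mul]
  have dstep : ∀ j : ℤ, d⁄dX ℂ ((u ^ (j + 1) : ℂ⟦X⟧ˣ) : ℂ⟦X⟧) =
      d⁄dX ℂ ((u ^ j : ℂ⟦X⟧ˣ) : ℂ⟦X⟧) * u + ((u ^ j : ℂ⟦X⟧ˣ) : ℂ⟦X⟧) * d⁄dX ℂ (u : ℂ⟦X⟧) := fun j => by
    rw [step, Derivation.leibniz, smul_eq_mul, smul_eq_mul]; ring
  induction k using Int.induction_on with
  | zero => simp
  | succ i ih =>
    rw [dstep, step, ih]; push_cast; ring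
  | pred i ih =>
    have h1 := dstep (-(i : ℤ) - 1)
    have h2 := step (-(i : ℤ) - 1)
    rw [sub_add_cancel] at h1 h2
    rw [h1, h2] at ih
    push_cast at ih ⊢
    have hu : (u : ℂ⟦X⟧) ≠ 0 := u.ne_zero
    apply mul_right_cancel₀ hu
    linear_combination ih

open PowerSeries in
/-- `1 - X` as a unit. -/
noncomputable def unitA : ℂ⟦X⟧ˣ :=
  Units.mkOfMulEqOne (1 - X) (1 - X)⁻¹ (PowerSeries.mul_inv_cancel _ (by simp))

open PowerSeries in
/-- `1 + X` as a unit. -/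
noncomputable def unitB : ℂ⟦X⟧ˣ :=
  Units.mkOfMulEqOne (1 + X) (1 + X)⁻¹ (PowerSeries.mul_inv_cancel _ (by simp))

open PowerSeries in
/-- `1 + X ^ 2` as a unit. -/
noncomputable def unitC : ℂ⟦X⟧ˣ :=
  Units.mkOfMulEqOne (1 + X ^ 2) (1 + X ^ 2)⁻¹ (PowerSeries.mul_inv_cancel _ (by simp))

open PowerSeries in
@[simp] theorem val_unitA : (unitA : ℂ⟦X⟧) = 1 - X := rfl
open PowerSeries in
@[simp] theorem val_unitB : (unitB : ℂ⟦X⟧) = 1 + X := rfl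
open PowerSeries in
@[simp] theorem val_unitC : (unitC : ℂ⟦X⟧) = 1 + X ^ 2 := rfl

open PowerSeries in
/-- The series `(1 - X) ^ p * (1 + X) ^ q * (1 + X ^ 2) ^ r` with integer exponents. -/
noncomputable def triple (p q r : ℤ) : ℂ⟦X⟧ :=
  ((unitA ^ p * unitB ^ q * unitC ^ r : ℂ⟦X⟧ˣ) : ℂ⟦X⟧)

open PowerSeries in
theorem triple_add_one_left (p q r : ℤ) : triple (p + 1) q r = triple p q r * (1 - X) := by
  simp only [triple, zpow_add_one, Units.val_mul, val_unitA]; ring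

open PowerSeries in
theorem triple_add_one_mid (p q r : ℤ) : triple p (q + 1) r = triple p q r * (1 + X) := by
  simp only [triple, zpow_add_one, Units.val_mul, val_unitB]; ring

open PowerSeries in
theorem triple_add_one_right (p q r : ℤ) : triple p q (r + 1) = triple p q r * (1 + X ^ 2) := by
  simp only [triple, zpow_add_one, Units.val_mul, val_unitC]; ring

open PowerSeries in
theorem derivative_triple (p q r : ℤ) :
    d⁄dX ℂ (triple p q r) * (1 - X ^ 4) = triple p q r *
      (-(p : ℂ⟦X⟧) * (1 + X) * (1 + X ^ 2) + (q : ℂ⟦X⟧) * (1 - X) * (1 + X ^ 2) +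
        2 * (r : ℂ⟦X⟧) * X * (1 - X ^ 2)) := by
  have ha := derivative_unit_zpow unitA p
  have hb := derivative_unit_zpow unitB q
  have hc := derivative_unit_zpow unitC r
  simp only [val_unitA, val_unitB, val_unitC, map_add, map_sub, derivative_X,
    Derivation.leibniz_pow, Derivation.map_one_eq_zero, smul_eq_mul, nsmul_eq_mul] at ha hb hc
  simp only [triple, Units.val_mul, Derivation.leibniz, smul_eq_mul]
  set a := ((unitA ^ p : ℂ⟦X⟧ˣ) : ℂ⟦X⟧)
  set b := ((unitB ^ q : ℂ⟦X⟧ˣ) : ℂ⟦X⟧)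
  set c := ((unitC ^ r : ℂ⟦X⟧ˣ) : ℂ⟦X⟧)
  push_cast at ha hb hc
  linear_combination b * c * (1 + X) * (1 + X ^ 2) * ha + a * c * (1 - X) * (1 + X ^ 2) * hb
    + a * b * (1 - X ^ 2) * hc

open PowerSeries in
theorem coeff_triple_succ (n : ℕ) (l : ℤ) :
    ((n : ℂ) + 1) * coeff (n + 1) (triple (5 * (n + 2 : ℤ) - 2 - l) (l - (n + 2)) (-(n + 2))) =
      2 * ((l : ℂ) - n - 5) * coeff n (triple (5 * (n + 1 : ℤ) - 2 - (l - 5)) (l - 5 - (n + 1)) (-(n + 1))) := by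
  obtain ⟨a, rfl⟩ : ∃ a : ℤ, l = a + n + 5 := ⟨l - n - 5, by ring⟩
  set h := triple (4 * n + 3 - a) (a - 1) (-(n + 2)) with hh
  have e1 : triple (5 * (n + 2 : ℤ) - 2 - (a + n + 5)) (a + n + 5 - (n + 2)) (-(n + 2)) = h * (1 + X) ^ 4 := by
    rw [hh, show (5 * (n + 2 : ℤ) - 2 - (a + n + 5)) = 4 * n + 3 - a by ring,
      show (a + n + 5 - (n + 2)) = a - 1 + 1 + 1 + 1 + 1 by ring]
    simp only [triple_add_one_mid]; ring
  have e2 : triple (5 * (n + 1 : ℤ) - 2 - (a + n + 5 - 5)) (a + n + 5 - 5 - (n + 1)) (-(n + 1)) = h * (1 + X ^ 2) := by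
    rw [hh, ← triple_add_one_right]; congr 1 <;> ring
  set V := triple (4 * n + 4 - a) a (-(n + 1)) with hV
  have e3 : V = h * ((1 - X) * (1 + X) * (1 + X ^ 2)) := by
    rw [hV, show 4 * n + 4 - a = 4 * n + 3 - a + 1 by ring, triple_add_one_left,
      show triple (4 * n + 3 - a) a (-(n + 1)) = triple (4 * n + 3 - a) (a - 1 + 1) (-(n + 2) + 1) by
        congr 1 <;> ring, triple_add_one_mid, triple_add_one_right]
    ring
  have key : X * d⁄dX ℂ V - (n + 1 : ℂ⟦X⟧) * V =
      2 * (a : ℂ⟦X⟧) * X * (h * (1 + X ^ 2)) - (n + 1 : ℂ⟦X⟧) * (h * (1 + X) ^ 4) := by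
    have hd := derivative_triple (4 * n + 4 - a) a (-(n + 1))
    rw [← hV] at hd
    have h0 : (1 - X ^ 4 : ℂ⟦X⟧) ≠ 0 := by
      intro h; simpa using congrArg constantCoeff h
    apply mul_right_cancel₀ h0
    push_cast at hd
    rw [e3] at hd ⊢
    linear_combination X * hd
  have hz : coeff (n + 1) (X * d⁄dX ℂ V - (n + 1 : ℂ⟦X⟧) * V) = 0 := by
    rw [map_sub, coeff_succ_X_mul, coeff_derivative,
      show (n + 1 : ℂ⟦X⟧) = C (n + 1 : ℂ) by simp, coeff_C_mul]
    ring
  rw [key, map_sub, show 2 * (a : ℂ⟦X⟧) * X * (h * (1 + X ^ 2)) =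
      C (2 * (a : ℂ)) * (X * (h * (1 + X ^ 2))) by
      rw [map_mul, map_ofNat, map_intCast]; ring, coeff_C_mul, coeff_succ_X_mul,
      show (n + 1 : ℂ⟦X⟧) = C (n + 1 : ℂ) by simp, coeff_C_mul] at hz
  rw [e1, e2]
  push_cast
  linear_combination -hz

open PowerSeries in
theorem coeff_triple (n : ℕ) (l : ℤ) :
    (n.factorial : ℂ) * coeff n (triple (5 * (n + 1 : ℤ) - 2 - l) (l - (n + 1)) (-(n + 1))) =
      2 ^ n * ∏ i ∈ Finset.range n, ((l : ℂ) - n - 4 - 4 * i) := by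
  induction n generalizing l with
  | zero =>
    simp only [triple, coeff_zero_eq_constantCoeff, Units.val_mul, map_mul]
    have : ∀ (u : ℂ⟦X⟧ˣ) (k : ℤ), constantCoeff (u : ℂ⟦X⟧) = 1 →
        constantCoeff ((u ^ k : ℂ⟦X⟧ˣ) : ℂ⟦X⟧) = 1 := by
      intro u k hu
      have h1 : Units.map (constantCoeff (R := ℂ)).toMonoidHom u = 1 := Units.ext hu
      have h2 : Units.map (constantCoeff (R := ℂ)).toMonoidHom (u ^ k) = 1 := by
        rw [map_zpow, h1, one_zpow]
      exact congrArg Units.val h2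
    rw [this, this, this]
    all_goals simp
  | succ n ih =>
    have h1 := coeff_triple_succ n l
    have h2 := ih (l - 5)
    rw [Finset.prod_range_succ', Nat.factorial_succ]
    push_cast at h1 h2 ⊢
    have h3 : ∏ k ∈ Finset.range n, ((l : ℂ) - (n + 1) - 4 - 4 * (k + 1)) =
        ∏ k ∈ Finset.range n, ((l : ℂ) - 5 - n - 4 - 4 * k) :=
      Finset.prod_congr rfl fun k _ => by ring
    rw [h3]
    rw [show ((n : ℤ) + 1 + 1) = n + 2 by ring]
    linear_combination (n.factorial : ℂ) * h1 + 2 * ((l : ℂ) - n - 5) * h2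

open PowerSeries in
/-- The series `(1 - X ^ 4) ^ (-n)`. -/
noncomputable def quarticSeries (n : ℕ) : ℂ⟦X⟧ :=
  expand 4 (by norm_num) (invOneSubPow ℂ n).val

open PowerSeries in
theorem quarticSeries_mul (n : ℕ) : quarticSeries n * (1 - X ^ 4) ^ n = 1 := by
  have h : (invOneSubPow ℂ n).val * (1 - X) ^ n = 1 := by
    rw [← invOneSubPow_inv_eq_one_sub_pow, Units.inv_eq_val_inv, Units.mul_inv]
  have h2 := congrArg (expand 4 (by norm_num)) h
  simpa [quarticSeries] using h2

open PowerSeries in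
theorem coeff_quarticSeries_of_not_dvd (n k : ℕ) (h : ¬ 4 ∣ k) : coeff k (quarticSeries n) = 0 :=
  coeff_expand_of_not_dvd _ _ _ h

open PowerSeries in
theorem coeff_quarticSeries_mul (m t : ℕ) :
    coeff (4 * t) (quarticSeries (m + 1)) = ((m + t).choose m : ℂ) := by
  rw [quarticSeries, coeff_expand_mul, invOneSubPow_val_succ_eq_mk_add_choose, coeff_mk]

open PowerSeries in
theorem constantCoeff_quarticSeries (n : ℕ) : constantCoeff (quarticSeries n) = 1 := by
  simpa using congrArg constantCoeff (quarticSeries_mul n)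

open PowerSeries in
/-- Residue moments at the vertex `1`. -/
noncomputable def momentOne (m l : ℕ) : ℂ :=
  coeff m ((1 - X) ^ (6 * m + 4 - l) * (1 + X) ^ l * quarticSeries (m + 1))

open PowerSeries in
/-- Residue moments at the vertex `0`. -/
noncomputable def momentZero (m l : ℕ) : ℂ :=
  coeff m (X ^ l * quarticSeries (m + 1))

open PowerSeries in
theorem factorial_mul_momentOne (m l : ℕ) (hl : l ≤ 6 * m + 4) :
    (m.factorial : ℂ) * momentOne m l = 2 ^ m * ∏ i ∈ Finset.range m, ((l : ℂ) - m - 4 - 4 * i) := by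
  have h := coeff_triple m l
  rw [Int.cast_natCast] at h
  rw [← h, momentOne]
  congr 2
  have h0 : ((1 - X ^ 4) ^ (m + 1) : ℂ⟦X⟧) ≠ 0 := by
    intro h; simpa using congrArg constantCoeff h
  apply mul_right_cancel₀ h0
  rw [mul_assoc, quarticSeries_mul, mul_one]
  have h1 : ((1 - X ^ 4) ^ (m + 1) : ℂ⟦X⟧) = ((unitA * unitB * unitC) ^ (m + 1) : ℂ⟦X⟧ˣ) := by
    simp only [Units.val_pow_eq_pow_val, Units.val_mul, val_unitA, val_unitB, val_unitC]
    congr 1; ring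
  have h2 : ((1 - X) ^ (6 * m + 4 - l) * (1 + X) ^ l : ℂ⟦X⟧) =
      (unitA ^ (6 * m + 4 - l) * unitB ^ l : ℂ⟦X⟧ˣ) := by simp
  rw [h1, h2, triple, ← Units.val_mul]
  congr 1
  rw [← zpow_natCast unitA, ← zpow_natCast unitB, mul_pow, mul_pow, ← zpow_natCast unitA (m + 1),
    ← zpow_natCast unitB (m + 1), ← zpow_natCast unitC (m + 1)]
  have e : unitA ^ (5 * (m + 1 : ℤ) - 2 - l) * unitB ^ ((l : ℤ) - (m + 1)) * unitC ^ (-(m + 1 : ℤ)) *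
      (unitA ^ ((m + 1 : ℕ) : ℤ) * unitB ^ ((m + 1 : ℕ) : ℤ) * unitC ^ ((m + 1 : ℕ) : ℤ)) =
      unitA ^ (5 * (m + 1 : ℤ) - 2 - l + (m + 1 : ℕ)) * unitB ^ ((l : ℤ) - (m + 1) + (m + 1 : ℕ)) *
      unitC ^ (-(m + 1 : ℤ) + (m + 1 : ℕ)) := by
    simp only [zpow_add]; ac_rfl
  rw [e]
  have i1 : (5 * (m + 1 : ℤ) - 2 - l + (m + 1 : ℕ)) = ((6 * m + 4 - l : ℕ) : ℤ) := by
    push_cast [Nat.cast_sub hl]; ring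
  have i2 : ((l : ℤ) - (m + 1) + (m + 1 : ℕ)) = l := by push_cast; ring
  have i3 : (-(m + 1 : ℤ) + (m + 1 : ℕ)) = 0 := by push_cast; ring
  rw [i1, i2, i3, zpow_zero, mul_one]

open PowerSeries in
theorem momentZero_of_lt (m l : ℕ) (h : m < l) : momentZero m l = 0 := by
  rw [momentZero, coeff_X_pow_mul', if_neg (by omega)]

open PowerSeries in
theorem momentZero_of_not_modEq (m l : ℕ) (h : l % 4 ≠ m % 4) : momentZero m l = 0 := by
  rw [momentZero, coeff_X_pow_mul']
  split_ifs with h1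
  · exact coeff_quarticSeries_of_not_dvd _ _ (by omega)
  · rfl

open PowerSeries in
theorem momentZero_self (m : ℕ) : momentZero m m = 1 := by
  rw [momentZero, coeff_X_pow_mul', if_pos le_rfl, Nat.sub_self, coeff_zero_eq_constantCoeff_apply,
    constantCoeff_quarticSeries]

open PowerSeries in
theorem momentOne_eq (m l : ℕ) (hl : l ≤ 5 * m + 3) (h : l % 4 = m % 4) :
    momentOne m l = (-8) ^ m * momentZero m l := by
  have hf := factorial_mul_momentOne m l (by omega)
  have hm : (m.factorial : ℂ) ≠ 0 := by exact_mod_cast m.factorial_ne_zero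
  apply mul_left_cancel₀ hm
  rw [hf]
  rcases lt_or_ge m l with h1 | h1
  · obtain ⟨s, rfl⟩ : ∃ s, l = m + 4 * (s + 1) := ⟨(l - m) / 4 - 1, by omega⟩
    rw [momentZero_of_lt _ _ h1, Finset.prod_eq_zero (i := s) (by simp; omega)]
    · simp
    · push_cast; ring
  · obtain ⟨t, ht⟩ : ∃ t, m = l + 4 * t := ⟨(m - l) / 4, by omega⟩
    rw [momentZero, coeff_X_pow_mul', if_pos h1, show m - l = 4 * t by omega, coeff_quarticSeries_mul]
    have e : ∏ i ∈ Finset.range m, ((l : ℂ) - m - 4 - 4 * i) =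
        (-4) ^ m * ∏ i ∈ Finset.range m, ((t : ℂ) + 1 + i) := by
      have hc : (-4 : ℂ) ^ m = ∏ _i ∈ Finset.range m, (-4 : ℂ) := by simp
      rw [hc, ← Finset.prod_mul_distrib]
      refine Finset.prod_congr rfl fun i _ => ?_
      have : (m : ℂ) = l + 4 * t := by exact_mod_cast congrArg (Nat.cast (R := ℂ)) ht
      rw [this]; ring
    have e2 : ∏ i ∈ Finset.range m, ((t : ℂ) + 1 + i) = m.factorial * ((m + t).choose m : ℂ) := by
      have := Nat.ascFactorial_eq_factorial_mul_choose t m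
      rw [Nat.ascFactorial_eq_prod_range] at this
      rw [add_comm m t]
      exact_mod_cast congrArg (Nat.cast (R := ℂ)) this
    rw [e, e2, show (-8 : ℂ) = 2 * (-4) by norm_num, mul_pow]
    ring

open Polynomial in
/-- The polynomial obtained by integrating `(x - y) ^ (6 * m + 2) * (2 * x + y - x ^ 4 * y - 2 * x ^ 3 * y ^ 2)`
in `y` against the functional with moments `s`. -/
noncomputable def kernelPoly (m : ℕ) (s : ℕ → ℂ) : ℂ[X] :=
  ∑ k ∈ Finset.range (6 * m + 3), C ((-1) ^ k * ((6 * m + 2).choose k : ℂ)) *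
    (C (2 * s k) * X ^ (6 * m + 2 - k + 1) + C (s (k + 1)) * X ^ (6 * m + 2 - k)
      - C (s (k + 1)) * X ^ (6 * m + 2 - k + 4) - C (2 * s (k + 2)) * X ^ (6 * m + 2 - k + 3))

open PowerSeries in
theorem eval_kernelPoly (m : ℕ) (s : ℕ → ℂ) (A B W : ℂ⟦X⟧)
    (hs : ∀ l ≤ 6 * m + 4, s l = coeff m (A ^ (6 * m + 4 - l) * B ^ l * W)) (x : ℂ) :
    (kernelPoly m s).eval x = coeff m ((C x * A - B) ^ (6 * m + 2) *
      (C (2 * x) * A ^ 2 + C (1 - x ^ 4) * A * B - C (2 * x ^ 3) * B ^ 2) * W) := by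
  rw [sub_eq_neg_add (C x * A) B, add_pow, Finset.sum_mul, Finset.sum_mul, map_sum, kernelPoly,
    Polynomial.eval_finsetSum]
  refine Finset.sum_congr rfl fun k hk => ?_
  have hk' : k ≤ 6 * m + 2 := by have := Finset.mem_range.1 hk; omega
  obtain ⟨j, hj⟩ : ∃ j, 6 * m + 2 = k + j := ⟨6 * m + 2 - k, by omega⟩
  rw [hs k (by omega), hs (k + 1) (by omega), hs (k + 2) (by omega),
    show 6 * m + 4 - k = j + 2 by omega, show 6 * m + 4 - (k + 1) = j + 1 by omega,
    show 6 * m + 4 - (k + 2) = j by omega, show 6 * m + 2 - k = j by omega]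
  have e : (-B) ^ k * (C x * A) ^ j * (((6 * m + 2).choose k : ℕ) : ℂ⟦X⟧) *
      (C (2 * x) * A ^ 2 + C (1 - x ^ 4) * A * B - C (2 * x ^ 3) * B ^ 2) * W =
      C ((-1) ^ k * ((6 * m + 2).choose k : ℂ) * (2 * x ^ (j + 1))) * (A ^ (j + 2) * B ^ k * W)
      + C ((-1) ^ k * ((6 * m + 2).choose k : ℂ) * (x ^ j - x ^ (j + 4))) * (A ^ (j + 1) * B ^ (k + 1) * W)
      - C ((-1) ^ k * ((6 * m + 2).choose k : ℂ) * (2 * x ^ (j + 3))) * (A ^ j * B ^ (k + 2) * W) := by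
    simp only [map_mul, map_sub, map_pow, map_one, map_neg, map_natCast, map_ofNat]
    rw [neg_pow]
    ring
  rw [e, map_sub, map_add, coeff_C_mul, coeff_C_mul, coeff_C_mul]
  simp only [Polynomial.eval_mul, Polynomial.eval_C, Polynomial.eval_sub, Polynomial.eval_add,
    Polynomial.eval_pow, Polynomial.eval_X]
  ring

open PowerSeries in
theorem eval_kernelPoly_momentOne (m : ℕ) (x : ℂ) (hx : 1 - x ≠ 0) :
    (1 - x) ^ (6 * m + 6) * (kernelPoly m (momentOne m)).eval ((1 + x) / (1 - x)) =
      -8 * 2 ^ (6 * m + 2) * (kernelPoly m (momentZero m)).eval x := by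
  rw [eval_kernelPoly m (momentOne m) (1 - X) (1 + X) _ (fun l _ => rfl),
    eval_kernelPoly m (momentZero m) 1 X (quarticSeries (m + 1)) (fun l _ => by simp [momentZero]),
    ← coeff_C_mul, ← coeff_C_mul]
  congr 1
  set y := (1 + x) / (1 - x) with hy
  have hxy : (1 - x) * y = 1 + x := by rw [hy]; field_simp
  have e1 : C (1 - x) * (C y * (1 - X) - (1 + X)) = C (2 : ℂ) * (C x * 1 - X) := by
    rw [mul_sub, ← mul_assoc, ← map_mul, hxy]
    simp only [map_add, map_sub, map_one, map_ofNat]; ring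
  have e2 : C ((1 - x) ^ 4) * (C (2 * y) * (1 - X) ^ 2 + C (1 - y ^ 4) * (1 - X) * (1 + X)
        - C (2 * y ^ 3) * (1 + X) ^ 2) =
      C (-8 : ℂ) * (C (2 * x) * 1 ^ 2 + C (1 - x ^ 4) * 1 * X - C (2 * x ^ 3) * X ^ 2) := by
    have f1 : (1 - x) ^ 4 * (2 * y) = 2 * (1 + x) * (1 - x) ^ 3 := by rw [← hxy]; ring
    have f2 : (1 - x) ^ 4 * (1 - y ^ 4) = (1 - x) ^ 4 - (1 + x) ^ 4 := by rw [← hxy]; ring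
    have f3 : (1 - x) ^ 4 * (2 * y ^ 3) = 2 * (1 + x) ^ 3 * (1 - x) := by rw [← hxy]; ring
    rw [mul_sub, mul_add, ← mul_assoc, ← mul_assoc, ← mul_assoc, ← mul_assoc, ← map_mul, ← map_mul,
      ← map_mul, f1, f2, f3]
    simp only [map_add, map_sub, map_one, map_ofNat, map_mul, map_pow, map_neg]; ring
  calc _ = (C (1 - x) * (C y * (1 - X) - (1 + X))) ^ (6 * m + 2) * (C ((1 - x) ^ 4) *
        (C (2 * y) * (1 - X) ^ 2 + C (1 - y ^ 4) * (1 - X) * (1 + X) - C (2 * y ^ 3) * (1 + X) ^ 2)) *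
        quarticSeries (m + 1) := by
        rw [mul_pow, ← map_pow, show (1 - x) ^ (6 * m + 6) = (1 - x) ^ (6 * m + 2) * (1 - x) ^ 4 by ring,
          map_mul]
        ring
    _ = _ := by
        rw [e1, e2, mul_pow, ← map_pow, map_mul C (-8) (2 ^ (6 * m + 2))]; ring

open Polynomial in
theorem coeff_kernelPoly_congr (m k : ℕ) (s s' : ℕ → ℂ)
    (h : ∀ l, (l + k = 6 * m + 3 ∨ (l + k = 6 * m + 7 ∧ 1 ≤ l)) → s l = s' l) :
    (kernelPoly m s).coeff k = (kernelPoly m s').coeff k := by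
  simp only [kernelPoly, finsetSum_coeff]
  refine Finset.sum_congr rfl fun i hi => ?_
  have hi' := Finset.mem_range.1 hi
  have h1 : k = 6 * m + 2 - i + 1 → s i = s' i := fun hk => h _ (by omega)
  have h2 : k = 6 * m + 2 - i → s (i + 1) = s' (i + 1) := fun hk => h _ (by omega)
  have h3 : k = 6 * m + 2 - i + 4 → s (i + 1) = s' (i + 1) := fun hk => h _ (by omega)
  have h4 : k = 6 * m + 2 - i + 3 → s (i + 2) = s' (i + 2) := fun hk => h _ (by omega)
  simp only [coeff_C_mul, coeff_sub, coeff_add, coeff_X_pow]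
  congr 1
  congr 1
  · congr 1
    · congr 1
      · split_ifs with hk
        · rw [h1 hk]
        · simp
      · split_ifs with hk
        · rw [h2 hk]
        · simp
    · split_ifs with hk
      · rw [h3 hk]
      · simp
  · split_ifs with hk
    · rw [h4 hk]
    · simp

open Polynomial in
theorem kernelPoly_smul (m : ℕ) (c : ℂ) (s : ℕ → ℂ) :
    kernelPoly m (fun l => c * s l) = C c * kernelPoly m s := by
  simp only [kernelPoly, Finset.mul_sum]
  refine Finset.sum_congr rfl fun i _ => ?_
  simp only [C_mul]
  ring

open Polynomial in
theorem coeff_kernelPoly_eq_zero (m k : ℕ) (s : ℕ → ℂ)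
    (h : ∀ l, (l + k = 6 * m + 3 ∨ (l + k = 6 * m + 7 ∧ 1 ≤ l)) → s l = 0) :
    (kernelPoly m s).coeff k = 0 := by
  rw [coeff_kernelPoly_congr m k s (fun l => 0 * s l) (by simpa using h), kernelPoly_smul]
  simp

open Polynomial in
theorem natDegree_kernelPoly_le (m : ℕ) (s : ℕ → ℂ) : (kernelPoly m s).natDegree ≤ 6 * m + 6 :=
  natDegree_le_iff_coeff_eq_zero.2 fun k hk => coeff_kernelPoly_eq_zero m k s fun l hl => by omega

open Polynomial in
theorem coeff_kernelPoly_top (m : ℕ) (s : ℕ → ℂ) : (kernelPoly m s).coeff (6 * m + 6) = -s 1 := by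
  simp only [kernelPoly, finsetSum_coeff]
  rw [Finset.sum_eq_single_of_mem 0 (by simp)]
  · simp only [coeff_C_mul, coeff_sub, coeff_add, coeff_X_pow]
    rw [if_neg (by omega), if_neg (by omega), if_pos (by omega), if_neg (by omega)]
    simp
  · intro i hi h0
    have hi' := Finset.mem_range.1 hi
    simp only [coeff_C_mul, coeff_sub, coeff_add, coeff_X_pow]
    rw [if_neg (by omega), if_neg (by omega), if_neg (by omega), if_neg (by omega)]
    simp

theorem coeff_kernelPoly_momentZero_of_not_modEq (m k : ℕ) (h : k % 4 ≠ (m + 3) % 4) :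
    (kernelPoly m (momentZero m)).coeff k = 0 :=
  coeff_kernelPoly_eq_zero m k _ fun l hl => momentZero_of_not_modEq m l (by omega)

theorem coeff_kernelPoly_momentZero_of_lt (m k : ℕ) (h : k < 5 * m + 3) :
    (kernelPoly m (momentZero m)).coeff k = 0 :=
  coeff_kernelPoly_eq_zero m k _ fun l hl => momentZero_of_lt m l (by omega)

theorem coeff_kernelPoly_momentOne_eq (m k : ℕ) (hk : 5 * m + 5 < k) (h : k % 4 = (m + 3) % 4) :
    (kernelPoly m (momentOne m)).coeff k = (-8) ^ m * (kernelPoly m (momentZero m)).coeff k := by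
  rw [← Polynomial.coeff_C_mul, ← kernelPoly_smul]
  exact coeff_kernelPoly_congr m k _ _ fun l hl => momentOne_eq m l (by omega) (by omega)

open Polynomial in
theorem coeff_kernelPoly_momentZero_low (m : ℕ) :
    (kernelPoly m (momentZero m)).coeff (5 * m + 3) * (m.factorial * (5 * m + 3).factorial) =
      (-1) ^ m * (3 * (3 * m + 2)) * (6 * m + 2).factorial := by
  have e : (kernelPoly m (momentZero m)).coeff (5 * m + 3) =
      ∑ i ∈ Finset.range (6 * m + 3), ((-1) ^ i * ((6 * m + 2).choose i : ℂ)) *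
        ((if i = m then 2 else 0) + if i + 1 = m then 1 else 0) := by
    simp only [kernelPoly, finsetSum_coeff]
    refine Finset.sum_congr rfl fun i hi => ?_
    have hi' := Finset.mem_range.1 hi
    simp only [coeff_C_mul, coeff_sub, coeff_add, coeff_X_pow]
    congr 1
    have h1 : (2 * momentZero m i * if 5 * m + 3 = 6 * m + 2 - i + 1 then 1 else 0) =
        if i = m then 2 else 0 := by
      by_cases h : i = m
      · rw [if_pos (by omega), if_pos h, h, momentZero_self]; norm_num
      · rw [if_neg (by omega), if_neg h, mul_zero]
    have h2 : (momentZero m (i + 1) * if 5 * m + 3 = 6 * m + 2 - i then 1 else 0) =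
        if i + 1 = m then 1 else 0 := by
      by_cases h : i + 1 = m
      · rw [if_pos (by omega), if_pos h, h, momentZero_self]; norm_num
      · rw [if_neg (by omega), if_neg h, mul_zero]
    have h3 : (momentZero m (i + 1) * if 5 * m + 3 = 6 * m + 2 - i + 4 then 1 else 0) = 0 := by
      split_ifs with h
      · rw [momentZero_of_lt m _ (by omega), zero_mul]
      · rw [mul_zero]
    have h4 : (2 * momentZero m (i + 2) * if 5 * m + 3 = 6 * m + 2 - i + 3 then 1 else 0) = 0 := by
      split_ifs with h
      · rw [momentZero_of_lt m _ (by omega), mul_zero, zero_mul]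
      · rw [mul_zero]
    rw [h1, h2, h3, h4, sub_zero, sub_zero]
  simp only [mul_add, Finset.sum_add_distrib, mul_ite, mul_zero, Finset.sum_ite_eq'] at e
  rw [if_pos (by simp; omega)] at e
  have c1 : ((6 * m + 2).choose m : ℂ) * (m.factorial * (5 * m + 2).factorial) = (6 * m + 2).factorial := by
    have := Nat.choose_mul_factorial_mul_factorial (show m ≤ 6 * m + 2 by omega)
    rw [show 6 * m + 2 - m = 5 * m + 2 by omega] at this
    rw [← this]; push_cast; ring
  have c2 : ((5 * m + 3).factorial : ℂ) = (5 * m + 3) * (5 * m + 2).factorial := by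
    rw [Nat.factorial_succ]; push_cast; ring
  rcases m with _ | m
  · rw [e]; norm_num [Nat.factorial]
  · have c3 : ((6 * (m + 1) + 2).choose m : ℂ) * (m.factorial * (5 * (m + 1) + 3).factorial) =
        (6 * (m + 1) + 2).factorial := by
      have := Nat.choose_mul_factorial_mul_factorial (show m ≤ 6 * (m + 1) + 2 by omega)
      rw [show 6 * (m + 1) + 2 - m = 5 * (m + 1) + 3 by omega] at this
      rw [← this]; push_cast; ring
    have c4 : ((m + 1).factorial : ℂ) = (m + 1) * m.factorial := by
      rw [Nat.factorial_succ]; push_cast; ring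
    simp only [add_left_inj, Finset.sum_ite_eq'] at e
    rw [if_pos (by simp; omega)] at e
    rw [e]
    push_cast at c1 c2 c3 c4 ⊢
    have c5 : (((6 * (m + 1) + 2).choose (m + 1) : ℕ) : ℂ) * ((m + 1).factorial * (5 * (m + 1) + 3).factorial) =
        (5 * (m + 1) + 3) * (6 * (m + 1) + 2).factorial := by
      rw [c2, ← c1]; ring
    have c6 : (((6 * (m + 1) + 2).choose m : ℕ) : ℂ) * ((m + 1).factorial * (5 * (m + 1) + 3).factorial) =
        (m + 1) * (6 * (m + 1) + 2).factorial := by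
      rw [c4, ← c3]; ring
    linear_combination 2 * (-1) ^ (m + 1) * c5 + (-1) ^ m * c6

open Polynomial in
/-- The octahedral polynomial `(X * (X ^ 4 - 1)) ^ n`. -/
noncomputable def octahedralPoly (n : ℕ) : ℂ[X] := X ^ n * (X ^ 4 - 1) ^ n

open Polynomial in
/-- The cofactor of `(1 - X) ^ n` in `octahedralPoly n`. -/
noncomputable def octahedralCofactor (n : ℕ) : ℂ[X] := X ^ n * (-((1 + X) * (1 + X ^ 2))) ^ n

open Polynomial in
theorem octahedralPoly_eq (n : ℕ) : octahedralPoly n = (1 - X) ^ n * octahedralCofactor n := by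
  rw [octahedralPoly, octahedralCofactor, mul_left_comm, ← mul_pow (1 - X)]
  congr 2
  ring

open Polynomial in
theorem monic_octahedralPoly (n : ℕ) : (octahedralPoly n).Monic :=
  (monic_X_pow n).mul ((monic_X_pow_sub_C (1 : ℂ) (n := 4) (by norm_num)).pow n)

open Polynomial in
theorem natDegree_octahedralPoly (n : ℕ) : (octahedralPoly n).natDegree = 5 * n := by
  rw [octahedralPoly, ← C_1, (monic_X_pow n).natDegree_mul
    ((monic_X_pow_sub_C (1 : ℂ) (n := 4) (by norm_num)).pow n), natDegree_pow, natDegree_pow, natDegree_X, natDegree_X_pow_sub_C]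
  ring

open Polynomial in
theorem natDegree_octahedralCofactor_le (n : ℕ) : (octahedralCofactor n).natDegree ≤ 4 * n := by
  have h : (-((1 + X) * (1 + X ^ 2)) : ℂ[X]).natDegree ≤ 3 := by compute_degree
  calc _ ≤ n * 1 + n * 3 := natDegree_mul_le_of_le
        (natDegree_pow_le_of_le n natDegree_X_le) (natDegree_pow_le_of_le n h)
    _ = _ := by ring

open Polynomial in
/-- Projection of a polynomial onto the exponents congruent to `e` modulo `4`. -/
noncomputable def residueProj (e : ℕ) (f : ℂ[X]) : ℂ[X] :=
  ∑ s ∈ Finset.range 4, C (Complex.I ^ (s * (3 * e)) / 4) * f.comp (C (Complex.I ^ s) * X)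

open Polynomial in
theorem coeff_residueProj (e k : ℕ) (f : ℂ[X]) :
    (residueProj e f).coeff k = if k % 4 = e % 4 then f.coeff k else 0 := by
  simp only [residueProj, finsetSum_coeff, coeff_C_mul, comp_C_mul_X_coeff]
  have h4 : ∀ t, Complex.I ^ t = Complex.I ^ (t % 4) := fun t => by
    conv_lhs => rw [← Nat.div_add_mod t 4, pow_add, pow_mul, Complex.I_pow_four, one_pow, one_mul]
  have h : ∀ s, Complex.I ^ (s * (3 * e)) / 4 * (f.coeff k * (Complex.I ^ s) ^ k) =
      f.coeff k / 4 * (Complex.I ^ ((3 * e + k) % 4)) ^ s := fun s => by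
    rw [← h4, ← pow_mul, ← pow_mul, add_mul, pow_add, mul_comm s, mul_comm s]; ring
  simp only [h]
  rw [← Finset.mul_sum]
  split_ifs with hk
  · rw [show (3 * e + k) % 4 = 0 by omega]; simp
  · have h3 : (3 * e + k) % 4 = 1 ∨ (3 * e + k) % 4 = 2 ∨ (3 * e + k) % 4 = 3 := by omega
    rcases h3 with h3 | h3 | h3 <;> rw [h3] <;>
      simp [Finset.sum_range_succ, pow_succ]

open Polynomial in
theorem dvd_of_comp_C_mul_X (n e : ℕ) (f : ℂ[X]) (hf : ∀ k, k % 4 ≠ e % 4 → f.coeff k = 0)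
    (h : (X - C 1) ^ n ∣ f) (a : ℂ) (ha : a ^ 4 = 1) : (X - C a) ^ n ∣ f := by
  have ha0 : a ≠ 0 := by rintro rfl; norm_num at ha
  have hc : f.comp (C (a ^ 3) * X) = C (a ^ (3 * e)) * f := by
    ext k
    rw [comp_C_mul_X_coeff, coeff_C_mul, ← pow_mul]
    by_cases hk : k % 4 = e % 4
    · have h4 : ∀ t, a ^ t = a ^ (t % 4) := fun t => by
        conv_lhs => rw [← Nat.div_add_mod t 4, pow_add, pow_mul, ha, one_pow, one_mul]
      rw [h4 (3 * k), h4 (3 * e), show 3 * k % 4 = 3 * e % 4 by omega, mul_comm]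
    · rw [hf k hk]; simp
  obtain ⟨q, hq⟩ := h
  have h2 : C (a ^ (3 * e)) * f = (C (a ^ 3) * (X - C a)) ^ n * q.comp (C (a ^ 3) * X) := by
    rw [← hc, hq, mul_comp, pow_comp, sub_comp, X_comp, C_comp, mul_sub, ← C_mul, ← pow_succ, ha]
  have h3 : (X - C a) ^ n ∣ C (a ^ (3 * e)) * f := by
    rw [h2, mul_pow]
    exact ((dvd_mul_left _ _).mul_right _)
  exact (IsUnit.dvd_mul_left (isUnit_C.2 (pow_ne_zero _ ha0).isUnit)).1 h3

open Polynomial in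
theorem octahedralPoly_dvd (n e : ℕ) (f : ℂ[X]) (hf : ∀ k, k % 4 ≠ e % 4 → f.coeff k = 0)
    (h : (X - C 1) ^ n ∣ f) (h0 : X ^ n ∣ f) : octahedralPoly n ∣ f := by
  have hfac : octahedralPoly n = (X - C 0) ^ n * ((X - C 1) ^ n * ((X - C (-1)) ^ n *
      ((X - C Complex.I) ^ n * (X - C (-Complex.I)) ^ n))) := by
    rw [octahedralPoly, ← mul_pow, ← mul_pow, ← mul_pow, ← mul_pow, ← mul_pow]
    congr 1
    have hI : (C Complex.I : ℂ[X]) ^ 2 = -1 := by rw [← C_pow, Complex.I_sq]; simp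
    simp only [C_neg, C_1, C_0]
    linear_combination (X ^ 3 - X) * hI
  have hI0 := Complex.I_ne_zero
  have hI1 : (1 : ℂ) - Complex.I ≠ 0 := fun h => by simpa using congrArg Complex.re h
  have hI2 : (1 : ℂ) + Complex.I ≠ 0 := fun h => by simpa using congrArg Complex.re h
  have cop : ∀ a b : ℂ, a - b ≠ 0 → IsCoprime ((X - C a) ^ n) ((X - C b) ^ n) := fun a b hab =>
    (isCoprime_X_sub_C_of_isUnit_sub hab.isUnit).pow
  have all := dvd_of_comp_C_mul_X n e f hf h
  rw [hfac]
  refine IsCoprime.mul_dvd ?_ (by simpa using h0) (IsCoprime.mul_dvd ?_ h (IsCoprime.mul_dvd ?_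
    (all _ (by norm_num)) (IsCoprime.mul_dvd ?_ (all _ Complex.I_pow_four)
      (all _ (by rw [neg_pow, Complex.I_pow_four]; norm_num)))))
  · refine IsCoprime.mul_right ?_ (IsCoprime.mul_right ?_ (IsCoprime.mul_right ?_ ?_)) <;>
      refine cop _ _ ?_ <;> simp
  · refine IsCoprime.mul_right ?_ (IsCoprime.mul_right ?_ ?_) <;> refine cop _ _ ?_
    · norm_num
    · exact hI1
    · simpa using hI2
  · refine IsCoprime.mul_right ?_ ?_ <;> refine cop _ _ ?_
    · intro h; apply hI2; linear_combination -h
    · intro h; apply hI1; linear_combination -h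
  · refine cop _ _ ?_
    rw [sub_neg_eq_add, ← two_mul]
    exact mul_ne_zero two_ne_zero hI0

open Polynomial in
theorem exists_shifted_expansion (Q : ℂ[X]) (n : ℕ) (h : Q.natDegree ≤ n) :
    ∃ d : ℕ → ℂ, Q = ∑ k ∈ Finset.range (n + 1), C (d k) * (1 + X) ^ k := by
  refine ⟨fun k => (taylor (-1) Q).coeff k, ?_⟩
  conv_lhs => rw [← sum_taylor_eq Q (-1)]
  rw [sum_over_range' _ (by simp) (n + 1) (by rw [natDegree_taylor]; omega)]
  refine Finset.sum_congr rfl fun k _ => ?_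
  rw [C_neg, C_1, sub_neg_eq_add, add_comm X]

open Polynomial in
theorem one_sub_pow_mul_octahedralPoly_eval (n : ℕ) (x : ℂ) (hx : 1 - x ≠ 0) :
    (1 - x) ^ (5 * n) * (octahedralPoly n).eval ((1 + x) / (1 - x)) =
      (-8) ^ n * (octahedralCofactor n).eval x := by
  simp only [octahedralPoly, octahedralCofactor, eval_mul, eval_pow, eval_X, eval_sub, eval_one,
    eval_neg, eval_add]
  rw [pow_mul, ← mul_pow, ← mul_pow, ← mul_pow, ← mul_pow]
  congr 1
  field_simp
  ring

open Polynomial in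
theorem one_sub_pow_mul_sum_eval (n : ℕ) (d : ℕ → ℂ) (x : ℂ) (hx : 1 - x ≠ 0) :
    (1 - x) ^ n * (∑ k ∈ Finset.range (n + 1), C (d k) * (1 + X) ^ k).eval ((1 + x) / (1 - x)) =
      (∑ k ∈ Finset.range (n + 1), C (d k * 2 ^ k) * (1 - X) ^ (n - k)).eval x := by
  simp only [eval_finsetSum, eval_mul, eval_C, eval_pow, eval_X, eval_sub, eval_one, eval_add]
  rw [Finset.mul_sum]
  refine Finset.sum_congr rfl fun k hk => ?_
  have hk' : k ≤ n := by have := Finset.mem_range.1 hk; omega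
  have h2 : (1 - x) * (1 + (1 + x) / (1 - x)) = 2 := by field_simp; ring
  rw [← h2, ← Nat.sub_add_cancel hk', pow_add, mul_pow, Nat.add_sub_cancel]
  ring

open Polynomial in
theorem exists_homogenization (R : ℂ[X]) (N : ℕ) (h : R.natDegree < N) :
    ∃ S : ℂ[X], ∀ x : ℂ, 1 - x ≠ 0 → (1 - x) ^ N * R.eval ((1 + x) / (1 - x)) = S.eval x := by
  refine ⟨∑ k ∈ Finset.range N, C (R.coeff k) * (1 + X) ^ k * (1 - X) ^ (N - k), fun x hx => ?_⟩
  rw [eval_eq_sum_range' h]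
  simp only [eval_finsetSum, eval_mul, eval_C, eval_pow, eval_X, eval_sub, eval_one, eval_add]
  rw [Finset.mul_sum]
  refine Finset.sum_congr rfl fun k hk => ?_
  have hk' : k ≤ N := by have := Finset.mem_range.1 hk; omega
  obtain ⟨y, hy⟩ : ∃ y, y = (1 + x) / (1 - x) := ⟨_, rfl⟩
  have h2 : (1 - x) * y = 1 + x := by rw [hy]; field_simp
  rw [← hy]
  conv_lhs => rw [← Nat.sub_add_cancel hk', pow_add]
  rw [← h2, mul_pow]
  ring

open Polynomial in
theorem eq_of_eval_eq_of_ne_one (p q : ℂ[X]) (h : ∀ x : ℂ, 1 - x ≠ 0 → p.eval x = q.eval x) : p = q := by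
  refine eq_of_infinite_eval_eq p q (Set.Infinite.mono (s := {1}ᶜ) ?_ (Set.finite_singleton 1).infinite_compl)
  intro x hx
  exact h x (sub_ne_zero.2 fun hh => hx hh.symm)

open Polynomial in
theorem X_sub_one_pow_dvd_residueProj_octahedralPoly_mul (n e : ℕ) (Q : ℂ[X]) :
    (X - C 1) ^ n ∣ residueProj e (octahedralPoly n * Q) := by
  refine Finset.dvd_sum fun s _ => Dvd.dvd.mul_left ?_ _
  rw [mul_comp, octahedralPoly, mul_comp, pow_comp, pow_comp]
  refine Dvd.dvd.mul_right (Dvd.dvd.mul_left (pow_dvd_pow_of_dvd ?_ n) _) _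
  rw [dvd_iff_isRoot]
  simp [pow_right_comm _ s 4, Complex.I_pow_four]

open Polynomial in
theorem X_sub_one_pow_dvd_residueProj_octahedralCofactor_mul (n e : ℕ) (Q : ℂ[X]) :
    (X - C 1) ^ n ∣ residueProj e (octahedralCofactor n * Q) - C (1 / 4) * (octahedralCofactor n * Q) := by
  rw [residueProj, Finset.sum_range_succ', add_sub_assoc]
  refine dvd_add (Finset.dvd_sum fun s hs => Dvd.dvd.mul_left ?_ _) ?_
  · rw [mul_comp, octahedralCofactor, mul_comp, pow_comp, pow_comp]
    refine Dvd.dvd.mul_right (Dvd.dvd.mul_left (pow_dvd_pow_of_dvd ?_ n) _) _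
    rw [dvd_iff_isRoot]
    have hs' := Finset.mem_range.1 hs
    interval_cases s <;> simp [pow_succ]
  · simp

open Polynomial in
theorem X_pow_dvd_residueProj (n e : ℕ) (f : ℂ[X]) (h : X ^ n ∣ f) : X ^ n ∣ residueProj e f := by
  rw [X_pow_dvd_iff] at h ⊢
  intro k hk
  rw [coeff_residueProj, h k hk, ite_self]

open Polynomial in
theorem exists_reflection (m : ℕ) : ∃ d : ℕ → ℂ, d (m + 1) = -momentOne m 1 ∧
    ∀ k, k % 4 = (m + 3) % 4 →
      (octahedralPoly (m + 1) * (∑ k ∈ Finset.range (m + 2), C (d k) * (1 + X) ^ k) +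
        octahedralCofactor (m + 1) * ∑ k ∈ Finset.range (m + 2),
          C (d k * 2 ^ k) * (1 - X) ^ (m + 1 - k)).coeff k =
      (-8) ^ m * (kernelPoly m (momentZero m)).coeff k := by
  set P1 := kernelPoly m (momentOne m) with hP1
  set P0 := kernelPoly m (momentZero m) with hP0
  have hmon := monic_octahedralPoly (m + 1)
  have hdiv := modByMonic_add_div P1 (octahedralPoly (m + 1))
  set R := P1 %ₘ octahedralPoly (m + 1) with hR
  have hRdeg : R.natDegree < 5 * (m + 1) := by
    rw [← natDegree_octahedralPoly]
    refine natDegree_modByMonic_lt _ hmon fun h => ?_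
    have := natDegree_octahedralPoly (m + 1)
    rw [h, natDegree_one] at this
    omega
  have hQdeg : (P1 /ₘ octahedralPoly (m + 1)).natDegree ≤ m + 1 := by
    rw [natDegree_divByMonic _ hmon, natDegree_octahedralPoly]
    have := natDegree_kernelPoly_le m (momentOne m)
    rw [← hP1] at this
    omega
  set Q := P1 /ₘ octahedralPoly (m + 1) with hQ
  obtain ⟨d, hd⟩ := exists_shifted_expansion Q (m + 1) hQdeg
  refine ⟨d, ?_, ?_⟩
  · rw [← coeff_kernelPoly_top, ← hP1, ← hdiv, coeff_add, coeff_eq_zero_of_natDegree_lt (by omega), zero_add,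
      show 6 * m + 6 = 5 * (m + 1) + (m + 1) by ring,
      coeff_mul_add_eq_of_natDegree_le (natDegree_octahedralPoly _).le hQdeg]
    have h1 : (octahedralPoly (m + 1)).coeff (5 * (m + 1)) = 1 := by
      conv_lhs => rw [← natDegree_octahedralPoly (m + 1)]
      exact hmon
    rw [h1, one_mul, hd, finsetSum_coeff, Finset.sum_eq_single_of_mem (m + 1) (by simp)]
    · rw [coeff_C_mul, coeff_one_add_X_pow]; simp
    · intro k hk hk'
      have := Finset.mem_range.1 hk
      rw [coeff_C_mul, coeff_one_add_X_pow, Nat.choose_eq_zero_of_lt (by omega)]; simp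
  · rw [show m + 2 = m + 1 + 1 by ring, ← hd]
    set Qh := ∑ k ∈ Finset.range (m + 1 + 1), C (d k * 2 ^ k) * (1 - X) ^ (m + 1 - k) with hQh
    obtain ⟨S, hS⟩ := exists_homogenization R _ hRdeg
    have hpoly : C (-8 * 2 ^ (6 * m + 2)) * P0 =
        C ((-8) ^ (m + 1)) * (octahedralCofactor (m + 1) * Qh) + (1 - X) ^ (m + 1) * S := by
      refine eq_of_eval_eq_of_ne_one _ _ fun x hx => ?_
      simp only [eval_add, eval_mul, eval_C, eval_pow, eval_sub, eval_one, eval_X]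
      rw [← eval_kernelPoly_momentOne m x hx, ← hS x hx, hQh, ← one_sub_pow_mul_sum_eval _ _ _ hx, ← hd,
        ← mul_assoc, ← one_sub_pow_mul_octahedralPoly_eval _ _ hx, ← hP1]
      conv_lhs => rw [← hdiv]
      rw [eval_add, eval_mul]
      ring
    have hQhdeg : Qh.natDegree ≤ m + 1 := by
      refine natDegree_sum_le_of_forall_le _ _ fun k _ => ?_
      refine (natDegree_C_mul_le _ _).trans ((natDegree_pow_le_of_le _ (m := 1) ?_).trans (by omega))
      compute_degree
    set E := octahedralPoly (m + 1) * Q + octahedralCofactor (m + 1) * Qh with hE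
    have hadd : residueProj (m + 3) E = residueProj (m + 3) (octahedralPoly (m + 1) * Q) +
        residueProj (m + 3) (octahedralCofactor (m + 1) * Qh) := by
      ext k
      simp only [coeff_add, coeff_residueProj, hE]
      split_ifs <;> simp
    set Z := residueProj (m + 3) E - C ((-8) ^ m) * P0 with hZ
    have hZres : ∀ k, k % 4 ≠ (m + 3) % 4 → Z.coeff k = 0 := fun k hk => by
      rw [hZ, coeff_sub, coeff_residueProj, if_neg hk, coeff_C_mul,
        coeff_kernelPoly_momentZero_of_not_modEq m k hk]
      simp
    have hZX : X ^ (m + 1) ∣ Z := by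
      refine dvd_sub (X_pow_dvd_residueProj _ _ _ (dvd_add ?_ ?_)) (Dvd.dvd.mul_left ?_ _)
      · exact ((dvd_mul_right _ _).mul_right _)
      · exact ((dvd_mul_right _ _).mul_right _)
      · rw [X_pow_dvd_iff]
        exact fun k hk => coeff_kernelPoly_momentZero_of_lt m k (by omega)
    have hZ1 : (X - C 1) ^ (m + 1) ∣ Z := by
      have h1 := X_sub_one_pow_dvd_residueProj_octahedralPoly_mul (m + 1) (m + 3) Q
      have h2 := X_sub_one_pow_dvd_residueProj_octahedralCofactor_mul (m + 1) (m + 3) Qh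
      have h3 : (X - C 1) ^ (m + 1) ∣ C (1 / 4) * (octahedralCofactor (m + 1) * Qh) - C ((-8) ^ m) * P0 := by
        have hu : (-(1 / 8) : ℂ) ^ m * (-8) ^ m = 1 := by rw [← mul_pow]; norm_num
        have hc : (2 : ℂ) ^ (6 * m + 2) = 4 * ((-8) ^ m * (-8) ^ m) := by
          rw [← mul_pow, pow_add, pow_mul]; norm_num; ring
        have c1 : 1 / 4 * (-(1 / 8) : ℂ) ^ (m + 1) * (-8 * 2 ^ (6 * m + 2)) = (-8) ^ m := by
          rw [hc, pow_succ]
          linear_combination (-8) ^ m * hu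
        have c2 : 1 / 4 * (-(1 / 8) : ℂ) ^ (m + 1) * (-8) ^ (m + 1) = 1 / 4 := by
          rw [pow_succ, pow_succ]
          linear_combination 1 / 4 * hu
        have e1 : (1 - X : ℂ[X]) ^ (m + 1) = (-1) ^ (m + 1) * (X - C 1) ^ (m + 1) := by
          rw [← mul_pow]; congr 1; simp
        refine ⟨-(C (1 / 4 * (-(1 / 8)) ^ (m + 1)) * (-1) ^ (m + 1) * S), ?_⟩
        have e2 := congrArg (C (1 / 4 * (-(1 / 8)) ^ (m + 1)) * ·) hpoly
        simp only [mul_add] at e2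
        rw [← mul_assoc, ← C_mul, c1, ← mul_assoc (C _) (C _), ← C_mul, c2, e1] at e2
        rw [e2]
        ring
      rw [hZ, hadd]
      have := dvd_add (dvd_add h1 h2) h3
      convert this using 1
      ring
    have hdvd := octahedralPoly_dvd (m + 1) (m + 3) Z hZres hZ1 hZX
    have hZ0 : Z = 0 := by
      refine eq_zero_of_dvd_of_degree_lt hdvd ?_
      rw [degree_eq_natDegree hmon.ne_zero, natDegree_octahedralPoly, degree_lt_iff_coeff_zero]
      intro k hk
      by_cases hk4 : k % 4 = (m + 3) % 4
      · rw [hZ, coeff_sub, coeff_residueProj, if_pos hk4, hE, coeff_add,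
          coeff_eq_zero_of_natDegree_lt (p := octahedralCofactor (m + 1) * Qh), add_zero,
          coeff_C_mul, ← coeff_kernelPoly_momentOne_eq m k (by omega) hk4, ← hP1]
        · conv_lhs => rw [← hdiv]
          rw [coeff_add, coeff_eq_zero_of_natDegree_lt (p := R) (by omega)]
          ring
        · refine lt_of_le_of_lt (natDegree_mul_le_of_le (natDegree_octahedralCofactor_le _) hQhdeg) ?_
          omega
      · exact hZres k hk4
    intro k hk
    have := congrArg (fun p => coeff p k) hZ0
    simp only [hZ, coeff_sub, coeff_residueProj, if_pos hk, coeff_C_mul, coeff_zero] at this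
    exact sub_eq_zero.1 this

open PowerSeries in
theorem exists_row_relation (m : ℕ) : ∃ d : ℕ → ℂ, d (m + 1) = -momentOne m 1 ∧
    ∀ j ≤ m, ∑ k ∈ Finset.range (m + 2), d k *
        coeff (4 * j + 2) ((1 + X) ^ k + C (2 ^ k) * (mk 1) ^ k) =
      if j = m then -(8 ^ m * (kernelPoly m (momentZero m)).coeff (5 * m + 3)) else 0 := by
  obtain ⟨d, hd, hcoeff⟩ := exists_reflection m
  refine ⟨d, hd, fun j hj => ?_⟩
  set F : ℂ⟦X⟧ := ∑ k ∈ Finset.range (m + 2), C (d k) * ((1 + X) ^ k + C (2 ^ k) * (mk 1) ^ k) with hF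
  have hsum : ∑ k ∈ Finset.range (m + 2), d k *
      coeff (4 * j + 2) ((1 + X) ^ k + C (2 ^ k) * (mk 1) ^ k) = coeff (4 * j + 2) F := by
    rw [hF, map_sum]
    simp only [coeff_C_mul]
  have hU : (1 - X : ℂ⟦X⟧) * mk 1 = 1 := by rw [mul_comm, mk_one_mul_one_sub_eq_one]
  set Q := ∑ k ∈ Finset.range (m + 2), Polynomial.C (d k) * (1 + Polynomial.X) ^ k with hQ
  set Qh := ∑ k ∈ Finset.range (m + 2),
    Polynomial.C (d k * 2 ^ k) * (1 - Polynomial.X) ^ (m + 1 - k) with hQh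
  set E := octahedralPoly (m + 1) * Q + octahedralCofactor (m + 1) * Qh with hE
  have hcast : F * (1 - X) ^ (m + 1) = (Q : ℂ⟦X⟧) * (1 - X) ^ (m + 1) + (Qh : ℂ⟦X⟧) := by
    have hQc : (Q : ℂ⟦X⟧) = ∑ k ∈ Finset.range (m + 2), C (d k) * (1 + X) ^ k := by
      rw [hQ, ← Polynomial.coeToPowerSeries.ringHom_apply, map_sum]
      simp
    have hQhc : (Qh : ℂ⟦X⟧) = ∑ k ∈ Finset.range (m + 2), C (d k * 2 ^ k) * (1 - X) ^ (m + 1 - k) := by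
      rw [hQh, ← Polynomial.coeToPowerSeries.ringHom_apply, map_sum]
      simp
    rw [hF, hQc, hQhc, Finset.sum_mul, Finset.sum_mul, ← Finset.sum_add_distrib]
    refine Finset.sum_congr rfl fun k hk => ?_
    have hk' : k ≤ m + 1 := by have := Finset.mem_range.1 hk; omega
    have h1 : (mk 1 : ℂ⟦X⟧) ^ k * (1 - X) ^ (m + 1) = (1 - X) ^ (m + 1 - k) := by
      rw [← Nat.sub_add_cancel hk', pow_add, Nat.add_sub_cancel, mul_left_comm, ← mul_pow, mul_comm (mk 1), hU,
        one_pow, mul_one]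
    rw [← h1, C.map_mul]
    ring
  have hEF : (E : ℂ⟦X⟧) = X ^ (m + 1) * (F * (X ^ 4 - 1) ^ (m + 1)) := by
    have hg : (octahedralPoly (m + 1) : ℂ⟦X⟧) = X ^ (m + 1) * (X ^ 4 - 1) ^ (m + 1) := by
      simp [octahedralPoly]
    have hg1 : (octahedralPoly (m + 1) : ℂ⟦X⟧) = (1 - X) ^ (m + 1) * (octahedralCofactor (m + 1) : ℂ⟦X⟧) := by
      rw [octahedralPoly_eq]
      simp
    have h0 : ((1 - X) ^ (m + 1) : ℂ⟦X⟧) ≠ 0 := by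
      intro h; simpa using congrArg constantCoeff h
    apply mul_right_cancel₀ h0
    rw [hE, Polynomial.coe_add, Polynomial.coe_mul, Polynomial.coe_mul]
    linear_combination (Qh : ℂ⟦X⟧) * (hg - hg1) + (Q : ℂ⟦X⟧) * (1 - X) ^ (m + 1) * hg -
      X ^ (m + 1) * (X ^ 4 - 1) ^ (m + 1) * hcast
  have hGcoeff : ∀ b, coeff b (F * (X ^ 4 - 1) ^ (m + 1)) = E.coeff (b + (m + 1)) := fun b => by
    rw [← Polynomial.coeff_coe, hEF, coeff_X_pow_mul]
  have hFG : F = C ((-1) ^ (m + 1)) * (quarticSeries (m + 1) * (F * (X ^ 4 - 1) ^ (m + 1))) := by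
    have h1 : ((X ^ 4 - 1) ^ (m + 1) : ℂ⟦X⟧) = C ((-1) ^ (m + 1)) * (1 - X ^ 4) ^ (m + 1) := by
      rw [map_pow, ← mul_pow]; congr 1; simp
    have h2 : (C ((-1 : ℂ) ^ (m + 1)) * C ((-1) ^ (m + 1)) : ℂ⟦X⟧) = 1 := by
      rw [← map_mul, ← mul_pow]; simp
    rw [h1]
    linear_combination (-F) * (C ((-1 : ℂ) ^ (m + 1)) * C ((-1) ^ (m + 1))) * quarticSeries_mul (m + 1) -
      F * h2
  have hterm : ∀ p ∈ Finset.HasAntidiagonal.antidiagonal (4 * j + 2), p ≠ (0, 4 * j + 2) →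
      coeff p.1 (quarticSeries (m + 1)) * coeff p.2 (F * (X ^ 4 - 1) ^ (m + 1)) = 0 := by
    rintro ⟨a, b⟩ hab hne
    have hab' : a + b = 4 * j + 2 := by simpa using hab
    by_cases h4 : 4 ∣ a
    · have ha : a ≠ 0 := by
        rintro rfl
        exact hne (by simpa using hab')
      rw [hGcoeff, hcoeff _ (by omega), coeff_kernelPoly_momentZero_of_lt m _ (by omega), mul_zero, mul_zero]
    · rw [coeff_quarticSeries_of_not_dvd _ _ h4, zero_mul]
  rw [hsum, hFG, coeff_C_mul, coeff_mul, Finset.sum_eq_single_of_mem (0, 4 * j + 2) (by simp) hterm, hGcoeff,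
    hcoeff _ (by omega), coeff_zero_eq_constantCoeff_apply, constantCoeff_quarticSeries]
  split_ifs with hjm
  · rw [hjm, show 4 * m + 2 + (m + 1) = 5 * m + 3 by ring]
    have : (-1 : ℂ) ^ m * (-8) ^ m = 8 ^ m := by rw [← mul_pow]; norm_num
    rw [pow_succ]
    linear_combination (-(kernelPoly m (momentZero m)).coeff (5 * m + 3)) * this
  · rw [coeff_kernelPoly_momentZero_of_lt m _ (by omega)]
    simp

theorem det_mul_of_row_relation {R : Type*} [CommRing R] (a : ℕ → ℕ → R) (m : ℕ) (c : ℕ → R) (r : R)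
    (h : ∀ j ≤ m, ∑ i ∈ Finset.range (m + 1), c i * a i j = if j = m then r else 0) :
    c m * (Matrix.of fun i j : Fin (m + 1) => a i j).det = r * (Matrix.of fun i j : Fin m => a i j).det := by
  have h1 := Matrix.det_updateRow_sum (Matrix.of fun i j : Fin (m + 1) => a i j) (Fin.last m) fun i => c i
  have hrow : ∀ j : Fin (m + 1), (∑ k : Fin (m + 1), c k • (Matrix.of fun i j : Fin (m + 1) => a i j) k) j =
      if (j : ℕ) = m then r else 0 := fun j => by
    rw [← h j (by omega), Finset.sum_apply, Finset.sum_range]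
    rfl
  rw [Fin.val_last, smul_eq_mul] at h1
  rw [← h1, Matrix.det_succ_row _ (Fin.last m), Finset.sum_eq_single (Fin.last m)]
  · rw [Matrix.updateRow_self, hrow, if_pos (Fin.val_last m), Fin.val_last, ← two_mul, pow_mul]
    have e : ((Matrix.of fun i j : Fin (m + 1) => a i j).updateRow (Fin.last m)
        (∑ k : Fin (m + 1), c k • (Matrix.of fun i j : Fin (m + 1) => a i j) k)).submatrix
        (Fin.last m).succAbove (Fin.last m).succAbove = Matrix.of fun i j : Fin m => a i j := by
      ext i j
      simp [Matrix.updateRow_apply, (Fin.castSucc_lt_last i).ne]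
    rw [e]
    simp
  · intro j _ hj
    rw [Matrix.updateRow_self, hrow, if_neg fun hh : (j : ℕ) = m => hj (Fin.ext hh)]
    simp
  · simp

open PowerSeries in
theorem coeff_one_add_X_pow_add (i j : ℕ) :
    coeff (4 * j + 2) ((1 + X) ^ (i + 1) + C (2 ^ (i + 1)) * (mk 1) ^ (i + 1) : ℂ⟦X⟧) =
      2 ^ (i + 1) * ((4 * j + i + 2).choose (4 * j + 2) : ℂ) + ((i + 1).choose (4 * j + 2) : ℂ) := by
  have h : ((1 + X : ℂ⟦X⟧) ^ (i + 1)) = (((1 + Polynomial.X) ^ (i + 1) : Polynomial ℂ) : ℂ⟦X⟧) := by simp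
  rw [map_add, coeff_C_mul, mk_one_pow_eq_mk_choose_add, coeff_mk, h, Polynomial.coeff_coe,
    Polynomial.coeff_one_add_X_pow, add_comm, show i + (4 * j + 2) = 4 * j + i + 2 by ring,
    ← Nat.choose_symm (show 4 * j + 2 ≤ 4 * j + i + 2 by omega), show 4 * j + i + 2 - (4 * j + 2) = i by omega]

theorem binom_natCast (a p : ℕ) : binom (a : ℤ) p = (a.choose p : ℝ) := by
  have h := descPochhammer_eval_eq_descFactorial ℝ a p
  rw [descPochhammer_eval_eq_prod_range, Nat.descFactorial_eq_factorial_mul_choose] at h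
  rw [binom, Int.cast_natCast, h]
  push_cast
  field_simp

theorem binom_sub_self_of_even (a p : ℕ) (hp : Even p) :
    binom ((p : ℤ) - 1 - a) p = (a.choose p : ℝ) := by
  rw [← binom_natCast, binom, binom, ← Finset.prod_range_reflect]
  congr 1
  have hc : (1 : ℝ) = ∏ _i ∈ Finset.range p, (-1 : ℝ) := by simp [hp.neg_one_pow]
  rw [← one_mul (∏ j ∈ Finset.range p, _), ← one_mul (∏ k ∈ Finset.range p, (((a : ℤ) : ℝ) - k)), one_mul, hc,
    ← Finset.prod_mul_distrib]
  refine Finset.prod_congr rfl fun k hk => ?_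
  have hk' := Finset.mem_range.1 hk
  rw [Nat.sub_sub, Nat.cast_sub (by omega)]
  push_cast
  ring

theorem Gamma_add_natCast (x : ℝ) (hx : 0 < x) (m : ℕ) :
    Real.Gamma (x + m) = (∏ k ∈ Finset.range m, (x + k)) * Real.Gamma x := by
  induction m with
  | zero => simp
  | succ m ih =>
    rw [Nat.cast_succ, ← add_assoc, Real.Gamma_add_one (by positivity), ih, Finset.prod_range_succ]
    ring

/-- The matrix whose determinant is evaluated. -/
noncomputable def binomMatrix (n : ℕ) : Matrix (Fin n) (Fin n) ℝ :=
  Matrix.of fun i j => (2 : ℝ) ^ ((i : ℕ) + 1) *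
    binom (4 * ((j : ℕ) : ℤ) + ((i : ℕ) : ℤ) + 2) (4 * (j : ℕ) + 2)
      + binom (4 * ((j : ℕ) : ℤ) - ((i : ℕ) : ℤ)) (4 * (j : ℕ) + 2)

open PowerSeries in
theorem ofReal_det_binomMatrix (n : ℕ) : ((binomMatrix n).det : ℂ) =
    (Matrix.of fun i j : Fin n => coeff (4 * (j : ℕ) + 2)
      ((1 + X) ^ ((i : ℕ) + 1) + C (2 ^ ((i : ℕ) + 1)) * (mk 1) ^ ((i : ℕ) + 1) : ℂ⟦X⟧)).det := by
  rw [← Complex.ofRealHom_eq_coe, RingHom.map_det]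
  congr 1
  ext i j
  have h1 : (4 * ((j : ℕ) : ℤ) + ((i : ℕ) : ℤ) + 2) = ((4 * (j : ℕ) + i + 2 : ℕ) : ℤ) := by push_cast; ring
  have h2 : (4 * ((j : ℕ) : ℤ) - ((i : ℕ) : ℤ)) = ((4 * (j : ℕ) + 2 : ℕ) : ℤ) - 1 - ((i + 1 : ℕ) : ℤ) := by
    push_cast; ring
  rw [RingHom.mapMatrix_apply, Matrix.map_apply, binomMatrix, Matrix.of_apply, Matrix.of_apply,
    coeff_one_add_X_pow_add, h1, h2, binom_natCast, binom_sub_self_of_even _ _ ⟨2 * j + 1, by ring⟩]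
  simp

theorem det_binomMatrix_succ (m : ℕ) :
    (binomMatrix (m + 1)).det * ((∏ k ∈ Finset.range m, ((m : ℝ) + 3 + 4 * k)) * (5 * m + 3).factorial) =
      4 ^ m * (3 * (3 * m + 2)) * (6 * m + 2).factorial * (binomMatrix m).det := by
  obtain ⟨d, hd, hrel⟩ := exists_row_relation m
  have h := det_mul_of_row_relation (fun i j => PowerSeries.coeff (4 * j + 2)
    ((1 + PowerSeries.X) ^ (i + 1) + PowerSeries.C (2 ^ (i + 1)) * (PowerSeries.mk 1) ^ (i + 1) : PowerSeries ℂ))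
    m (fun i => d (i + 1)) _ (fun j hj => by
      rw [← hrel j hj, Finset.sum_range_succ' _ (m + 1)]
      simp [PowerSeries.coeff_one])
  beta_reduce at h
  rw [← ofReal_det_binomMatrix, ← ofReal_det_binomMatrix, hd] at h
  have hlow := coeff_kernelPoly_momentZero_low m
  have htop := factorial_mul_momentOne m 1 (by omega)
  have hprod : ∏ i ∈ Finset.range m, (((1 : ℕ) : ℂ) - m - 4 - 4 * i) =
      (-1) ^ m * ∏ k ∈ Finset.range m, ((m : ℂ) + 3 + 4 * k) := by
    have hc : (-1 : ℂ) ^ m = ∏ _i ∈ Finset.range m, (-1 : ℂ) := by simp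
    rw [hc, ← Finset.prod_mul_distrib]
    refine Finset.prod_congr rfl fun k _ => ?_
    push_cast; ring
  rw [hprod] at htop
  have h2 : ((2 : ℂ) ^ m * (-1) ^ m) ≠ 0 := by
    rw [← mul_pow]; exact pow_ne_zero _ (by norm_num)
  have h8 : (8 : ℂ) ^ m = 2 ^ m * 4 ^ m := by rw [← mul_pow]; norm_num
  have key : ((binomMatrix (m + 1)).det : ℂ) *
      ((∏ k ∈ Finset.range m, ((m : ℂ) + 3 + 4 * k)) * (5 * m + 3).factorial) =
      4 ^ m * (3 * (3 * m + 2)) * (6 * m + 2).factorial * ((binomMatrix m).det : ℂ) := by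
    apply mul_left_cancel₀ h2
    rw [h8] at h
    linear_combination (-((binomMatrix (m + 1)).det : ℂ) * (5 * m + 3).factorial) * htop
      + (2 ^ m * 4 ^ m * ((binomMatrix m).det : ℂ)) * hlow - (m.factorial * (5 * m + 3).factorial : ℂ) * h
  exact_mod_cast key

theorem det_binomMatrix (n : ℕ) : (binomMatrix n).det =
    ∏ i ∈ Finset.Icc 1 n,
      Real.Gamma (6 * (i : ℝ) - 1) * Real.Gamma (((i : ℝ) + 2) / 4)
        / (2 * (2 * (i : ℝ) - 1) * Real.Gamma (5 * (i : ℝ) - 1) * Real.Gamma ((5 * (i : ℝ) - 2) / 4)) := by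
  induction n with
  | zero => simp
  | succ m ih =>
    rw [Finset.prod_Icc_succ_top (by omega), ← ih]
    have h := det_binomMatrix_succ m
    set P := ∏ k ∈ Finset.range m, ((m : ℝ) + 3 + 4 * k) with hP
    have hP0 : P ≠ 0 := Finset.prod_ne_zero_iff.2 fun k _ => by positivity
    have g1 : Real.Gamma (6 * ((m + 1 : ℕ) : ℝ) - 1) = (6 * m + 4).factorial := by
      rw [← Real.Gamma_nat_eq_factorial]; congr 1; push_cast; ring
    have g2 : Real.Gamma (5 * ((m + 1 : ℕ) : ℝ) - 1) = (5 * m + 3).factorial := by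
      rw [← Real.Gamma_nat_eq_factorial]; congr 1; push_cast; ring
    have g3 : Real.Gamma ((5 * ((m + 1 : ℕ) : ℝ) - 2) / 4) =
        P / 4 ^ m * Real.Gamma ((((m + 1 : ℕ) : ℝ) + 2) / 4) := by
      rw [show (5 * ((m + 1 : ℕ) : ℝ) - 2) / 4 = (((m + 1 : ℕ) : ℝ) + 2) / 4 + m by push_cast; ring,
        Gamma_add_natCast _ (by positivity)]
      congr 1
      have hc : (4 : ℝ) ^ m = ∏ _i ∈ Finset.range m, (4 : ℝ) := by simp
      rw [hP, hc, ← Finset.prod_div_distrib]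
      refine Finset.prod_congr rfl fun k _ => ?_
      push_cast; ring
    have g4 : ((6 * m + 4).factorial : ℝ) = (6 * m + 4) * (6 * m + 3) * (6 * m + 2).factorial := by
      rw [Nat.factorial_succ, Nat.factorial_succ]; push_cast; ring
    have hG : Real.Gamma ((((m + 1 : ℕ) : ℝ) + 2) / 4) ≠ 0 := (Real.Gamma_pos_of_pos (by positivity)).ne'
    have hF : ((5 * m + 3).factorial : ℝ) ≠ 0 := by positivity
    have hm : (2 * (m : ℝ) + 1) ≠ 0 := by positivity
    rw [g1, g2, g3, g4, show 2 * ((m + 1 : ℕ) : ℝ) - 1 = 2 * m + 1 by push_cast; ring]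
    generalize Real.Gamma ((((m + 1 : ℕ) : ℝ) + 2) / 4) = G at hG ⊢
    apply mul_right_cancel₀ (mul_ne_zero hP0 hF)
    rw [h]
    field_simp
    ring

end OctahedralDet

theorem stmt_0 (n : ℕ) (hn : 0 < n) :
    (Matrix.of fun i j : Fin n =>
        (2 : ℝ) ^ ((i : ℕ) + 1) * binom (4 * ((j : ℕ) : ℤ) + ((i : ℕ) : ℤ) + 2) (4 * (j : ℕ) + 2)
          + binom (4 * ((j : ℕ) : ℤ) - ((i : ℕ) : ℤ)) (4 * (j : ℕ) + 2)).det =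
      ∏ i ∈ Finset.Icc 1 n,
          Real.Gamma (6 * (i : ℝ) - 1) * Real.Gamma (((i : ℝ) + 2) / 4)
            / (2 * (2 * (i : ℝ) - 1) * Real.Gamma (5 * (i : ℝ) - 1) * Real.Gamma ((5 * (i : ℝ) - 2) / 4)) := by
  exact OctahedralDet.det_binomMatrix n
end

section
/- For every positive integer n, the determinant of the n×n matrix whose (i,j)-entry (0 ≤ i,j ≤ n−1) is 2^{i}·binom(4j+i+3, 4j+3) + binom(4j−i+3, 4j+3) equals 2 times the product over i = 1 to n of Γ(6i−1)·Γ((i+3)/4) / (Γ(5i)·Γ((5i−1)/4)). -/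
open scoped BigOperators

section

open Polynomial

theorem choose_mul_coeff_one_add_pow_mul_one_sub_pow {N b i : ℕ} (hb : b ≤ N) (hi : i ≤ N) :
    (N.choose b : ℝ) * ((1 + X : ℝ[X]) ^ b * (1 - X) ^ (N - b)).coeff i =
      (-1) ^ i * (N.choose i : ℝ) * ((1 + X : ℝ[X]) ^ (N - i) * (1 - X) ^ i).coeff b := by
  have h : (X * C (1 + X) + C (1 - X) : ℝ[X][X]) ^ N = (C (-X) * (1 - X) + (1 + X)) ^ N := by
    congr 1
    simp only [map_add, map_sub, map_neg, map_one]
    ring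
  have h1 : ((X * C (1 + X) + C (1 - X) : ℝ[X][X]) ^ N).coeff b =
      (1 + X) ^ b * (1 - X) ^ (N - b) * (N.choose b : ℝ[X]) := by
    rw [add_pow, finsetSum_coeff, Finset.sum_eq_single b]
    · rw [mul_pow, ← C_pow, ← C_pow, ← C_eq_natCast, mul_assoc, mul_assoc, ← C_mul, ← C_mul,
        coeff_X_pow_mul', if_pos le_rfl, Nat.sub_self, coeff_C_zero, mul_assoc]
    · intro k _ hk
      rw [mul_pow, ← C_pow, ← C_pow, ← C_eq_natCast, mul_assoc, mul_assoc, ← C_mul, ← C_mul,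
        coeff_X_pow_mul']
      split_ifs with hkb
      · rw [coeff_C, if_neg (by omega)]
      · rfl
    · intro hk
      exact absurd (Finset.mem_range.mpr (by omega)) hk
  have h2 : (((C (-X) * (1 - X) + (1 + X) : ℝ[X][X]) ^ N).coeff b).coeff i =
      (-1) ^ i * (N.choose i : ℝ) * ((1 + X : ℝ[X]) ^ (N - i) * (1 - X) ^ i).coeff b := by
    have hterm : ∀ k, (((C (-X) * (1 - X)) ^ k * (1 + X) ^ (N - k) * (N.choose k : ℝ[X][X]) :
        ℝ[X][X]).coeff b) = X ^ k * C ((-1) ^ k * (N.choose k : ℝ) *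
          ((1 + X : ℝ[X]) ^ (N - k) * (1 - X) ^ k).coeff b) := by
      intro k
      have : ((C (-X) * (1 - X)) ^ k * (1 + X) ^ (N - k) * (N.choose k : ℝ[X][X]) : ℝ[X][X]) =
          C ((-X) ^ k * (N.choose k : ℝ[X])) *
            (((1 + X : ℝ[X]) ^ (N - k) * (1 - X) ^ k).map (C : ℝ →+* ℝ[X])) := by
        simp only [Polynomial.map_mul, Polynomial.map_pow, Polynomial.map_add, Polynomial.map_sub,
          Polynomial.map_one, map_X, mul_pow, C_mul, C_pow, C_eq_natCast]
        ring
      rw [this, coeff_C_mul, coeff_map, neg_pow]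
      simp only [C_mul, C_pow, C_neg, C_1, C_eq_natCast]
      ring
    rw [add_pow, finsetSum_coeff, finsetSum_coeff, Finset.sum_eq_single i]
    · rw [hterm, coeff_X_pow_mul', if_pos le_rfl, Nat.sub_self, coeff_C_zero]
    · intro k _ hk
      rw [hterm, coeff_X_pow_mul']
      split_ifs with hki
      · rw [coeff_C, if_neg (by omega)]
      · rfl
    · intro hk
      exact absurd (Finset.mem_range.mpr (by omega)) hk
  rw [← h2, ← h, h1, ← C_eq_natCast, coeff_mul_C]
  ring

end

open PowerSeries

theorem derivative_units_zpow (u : (ℝ⟦X⟧)ˣ) (k : ℤ) :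
    d⁄dX ℝ ((u ^ k : (ℝ⟦X⟧)ˣ) : ℝ⟦X⟧) =
      (k : ℝ⟦X⟧) * ((u ^ (k - 1) : (ℝ⟦X⟧)ˣ) : ℝ⟦X⟧) * d⁄dX ℝ (u : ℝ⟦X⟧) := by
  have key : ∀ m : ℤ, d⁄dX ℝ ((u ^ (m + 1) : (ℝ⟦X⟧)ˣ) : ℝ⟦X⟧) =
      (u : ℝ⟦X⟧) * d⁄dX ℝ ((u ^ m : (ℝ⟦X⟧)ˣ) : ℝ⟦X⟧) +
        ((u ^ m : (ℝ⟦X⟧)ˣ) : ℝ⟦X⟧) * d⁄dX ℝ (u : ℝ⟦X⟧) := by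
    intro m
    rw [zpow_add_one, Units.val_mul, Derivation.leibniz, smul_eq_mul, smul_eq_mul]
    ring
  have shift : ∀ m : ℤ, ((u ^ m : (ℝ⟦X⟧)ˣ) : ℝ⟦X⟧) = ((u ^ (m - 1) : (ℝ⟦X⟧)ˣ) : ℝ⟦X⟧) * u := by
    intro m
    rw [← Units.val_mul, ← zpow_add_one, sub_add_cancel]
  induction k using Int.induction_on with
  | zero => simp
  | succ m ih =>
    rw [key, ih, add_sub_cancel_right, shift m]
    push_cast
    ring
  | pred m ih =>
    have h := key (-(m : ℤ) - 1)
    rw [sub_add_cancel, ih] at h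
    have h2 := shift (-(m : ℤ) - 1)
    apply (Units.mul_right_inj u).mp
    rw [eq_sub_of_add_eq h.symm, h2]
    push_cast
    ring

/-- The power series `1 + X`, as a unit. -/
noncomputable def unitOneAddX : (ℝ⟦X⟧)ˣ :=
  (PowerSeries.isUnit_iff_constantCoeff.mpr (by simp) : IsUnit (1 + X : ℝ⟦X⟧)).unit

/-- The power series `1 - X`, as a unit. -/
noncomputable def unitOneSubX : (ℝ⟦X⟧)ˣ :=
  (PowerSeries.isUnit_iff_constantCoeff.mpr (by simp) : IsUnit (1 - X : ℝ⟦X⟧)).unit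

/-- The power series `1 + X ^ 2`, as a unit. -/
noncomputable def unitOneAddXSq : (ℝ⟦X⟧)ˣ :=
  (PowerSeries.isUnit_iff_constantCoeff.mpr (by simp) : IsUnit (1 + X ^ 2 : ℝ⟦X⟧)).unit

theorem val_unitOneAddX : (unitOneAddX : ℝ⟦X⟧) = 1 + X := rfl

theorem val_unitOneSubX : (unitOneSubX : ℝ⟦X⟧) = 1 - X := rfl

theorem val_unitOneAddXSq : (unitOneAddXSq : ℝ⟦X⟧) = 1 + X ^ 2 := rfl

/-- The power series `(1 + X) ^ e * (1 - X) ^ (4 n + 2 - e) / (1 + X ^ 2) ^ (n + 1)`, as a unit. -/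
noncomputable def kernelUnit (n : ℕ) (e : ℤ) : (ℝ⟦X⟧)ˣ :=
  unitOneAddX ^ e * unitOneSubX ^ (4 * (n : ℤ) + 2 - e) * unitOneAddXSq ^ (-(n : ℤ) - 1)

theorem coeff_kernelUnit_succ (n : ℕ) (e : ℤ) :
    ((n : ℝ) + 1) * coeff (n + 1) (kernelUnit (n + 1) e : ℝ⟦X⟧) =
      2 * ((e : ℝ) - 3) * coeff n (kernelUnit n (e - 4) : ℝ⟦X⟧) := by
  set Z₁ : (ℝ⟦X⟧)ˣ := unitOneAddX ^ (e - 4) with hZ₁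
  set Z₂ : (ℝ⟦X⟧)ˣ := unitOneSubX ^ (4 * (n : ℤ) + 6 - e) with hZ₂
  set Z₃ : (ℝ⟦X⟧)ˣ := unitOneAddXSq ^ (-(n : ℤ) - 2) with hZ₃
  have e1 : (unitOneAddX ^ (e - 3) : (ℝ⟦X⟧)ˣ) = Z₁ * unitOneAddX := by
    rw [hZ₁, ← zpow_add_one]; congr 1; ring
  have e2 : (unitOneSubX ^ (4 * (n : ℤ) + 7 - e) : (ℝ⟦X⟧)ˣ) = Z₂ * unitOneSubX := by
    rw [hZ₂, ← zpow_add_one]; congr 1; ring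
  have e3 : (unitOneAddXSq ^ (-(n : ℤ) - 1) : (ℝ⟦X⟧)ˣ) = Z₃ * unitOneAddXSq := by
    rw [hZ₃, ← zpow_add_one]; congr 1; ring
  have d1 := derivative_units_zpow unitOneAddX (e - 3)
  have d2 := derivative_units_zpow unitOneSubX (4 * (n : ℤ) + 7 - e)
  have d3 := derivative_units_zpow unitOneAddXSq (-(n : ℤ) - 1)
  rw [show e - 3 - 1 = e - 4 by ring, ← hZ₁, e1] at d1
  rw [show 4 * (n : ℤ) + 7 - e - 1 = 4 * (n : ℤ) + 6 - e by ring, ← hZ₂, e2] at d2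
  rw [show -(n : ℤ) - 1 - 1 = -(n : ℤ) - 2 by ring, ← hZ₃, e3] at d3
  have k1 : kernelUnit (n + 1) e = Z₁ * unitOneAddX ^ 4 * Z₂ * Z₃ := by
    rw [kernelUnit, hZ₁, hZ₂, hZ₃]
    congr 1
    · congr 1
      · rw [← zpow_natCast, ← zpow_add]; congr 1; push_cast; ring
    · congr 1; push_cast; ring
  have k2 : kernelUnit n (e - 4) = Z₁ * Z₂ * (Z₃ * unitOneAddXSq) := by
    rw [kernelUnit, hZ₁, hZ₂, ← e3]
    congr 3
    ring
  set B : ℝ⟦X⟧ := ((Z₁ * unitOneAddX : (ℝ⟦X⟧)ˣ) : ℝ⟦X⟧) * ((Z₂ * unitOneSubX : (ℝ⟦X⟧)ˣ) : ℝ⟦X⟧) *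
    ((Z₃ * unitOneAddXSq : (ℝ⟦X⟧)ˣ) : ℝ⟦X⟧) with hB
  have hder : ((n : ℝ⟦X⟧) + 1) * B - X * d⁄dX ℝ B =
      ((n : ℝ⟦X⟧) + 1) * (kernelUnit (n + 1) e : ℝ⟦X⟧) -
        X * ((2 * ((e : ℝ⟦X⟧) - 3)) * (kernelUnit n (e - 4) : ℝ⟦X⟧)) := by
    rw [k1, k2, hB, Derivation.leibniz, Derivation.leibniz, d1, d2, d3]
    simp only [smul_eq_mul, Units.val_mul, Units.val_pow_eq_pow_val, val_unitOneAddX,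
      val_unitOneSubX, val_unitOneAddXSq, map_add, map_sub, derivative_X, Derivation.leibniz_pow,
      Derivation.map_one_eq_zero]
    push_cast
    simp only [nsmul_eq_mul]
    push_cast
    ring
  have hc := congrArg (coeff (n + 1)) hder
  have hn : ((n : ℝ⟦X⟧) + 1) = C ((n : ℝ) + 1) := by simp
  have he : (2 * ((e : ℝ⟦X⟧) - 3)) = C (2 * ((e : ℝ) - 3)) := by
    simp [map_ofNat]
  rw [map_sub, map_sub, hn, he, coeff_C_mul, coeff_C_mul, coeff_succ_X_mul, coeff_succ_X_mul,
    coeff_C_mul, coeff_derivative] at hc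
  linarith

/-- The generalized binomial coefficient `c (c - 1) ⋯ (c - n + 1) / n!` with real upper argument. -/
noncomputable def realBinom (c : ℝ) (n : ℕ) : ℝ :=
  (∏ k ∈ Finset.range n, (c - (k : ℝ))) / (n.factorial : ℝ)

theorem realBinom_succ (c : ℝ) (n : ℕ) :
    ((n : ℝ) + 1) * realBinom c (n + 1) = c * realBinom (c - 1) n := by
  have h : ((n : ℝ) + 1) ≠ 0 := by positivity
  have h' : (n.factorial : ℝ) ≠ 0 := by positivity
  rw [realBinom, realBinom, Finset.prod_range_succ', Nat.factorial_succ]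
  have : ∀ k ∈ Finset.range n, c - ((k + 1 : ℕ) : ℝ) = c - 1 - (k : ℝ) := by
    intro k _; push_cast; ring
  rw [Finset.prod_congr rfl this]
  push_cast
  field_simp
  ring

theorem constantCoeff_units_zpow {u : (ℝ⟦X⟧)ˣ} (hu : constantCoeff (u : ℝ⟦X⟧) = 1) (k : ℤ) :
    constantCoeff ((u ^ k : (ℝ⟦X⟧)ˣ) : ℝ⟦X⟧) = 1 := by
  have h1 : Units.map (constantCoeff (R := ℝ)).toMonoidHom u = 1 := Units.ext hu
  have h2 : Units.map (constantCoeff (R := ℝ)).toMonoidHom (u ^ k) = 1 := by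
    rw [map_zpow, h1, one_zpow]
  exact congrArg Units.val h2

theorem coeff_kernelUnit (n : ℕ) (e : ℤ) :
    coeff n (kernelUnit n e : ℝ⟦X⟧) = 8 ^ n * realBinom (((e : ℝ) - 3) / 4) n := by
  induction n generalizing e with
  | zero =>
    rw [coeff_zero_eq_constantCoeff_apply, kernelUnit, Units.val_mul, Units.val_mul, map_mul,
      map_mul, constantCoeff_units_zpow (u := unitOneAddX) (by simp [val_unitOneAddX]),
      constantCoeff_units_zpow (u := unitOneSubX) (by simp [val_unitOneSubX]),
      constantCoeff_units_zpow (u := unitOneAddXSq) (by simp [val_unitOneAddXSq])]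
    simp [realBinom]
  | succ n ih =>
    have h : ((n : ℝ) + 1) ≠ 0 := by positivity
    have h1 := coeff_kernelUnit_succ n e
    have h2 := realBinom_succ (((e : ℝ) - 3) / 4) n
    rw [ih] at h1
    push_cast at h1
    rw [show ((e : ℝ) - 4 - 3) / 4 = ((e : ℝ) - 3) / 4 - 1 by ring] at h1
    apply mul_left_cancel₀ h
    rw [h1, pow_succ]
    linear_combination (-8 * 8 ^ n) * h2

theorem one_sub_pow_mul_sum_choose_add {R : Type*} [CommRing R] (y : R) (m L : ℕ) :
    ∃ g : R, (1 - y) ^ (m + 1) * ∑ i ∈ Finset.range L, ((m + i).choose m : R) * y ^ i =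
      1 + y ^ L * g := by
  induction m with
  | zero =>
    refine ⟨-1, ?_⟩
    have := mul_neg_geom_sum y L
    simp only [zero_add, Nat.choose_zero_right, Nat.cast_one, one_mul, pow_one]
    rw [this]; ring
  | succ m ih =>
    obtain ⟨g, hg⟩ := ih
    have h : (1 - y) * ∑ i ∈ Finset.range L, ((m + 1 + i).choose (m + 1) : R) * y ^ i =
        ∑ i ∈ Finset.range L, ((m + i).choose m : R) * y ^ i -
          ((m + L).choose (m + 1) : R) * y ^ L := by
      clear hg
      induction L with
      | zero => simp
      | succ L ih =>
        rw [Finset.sum_range_succ, Finset.sum_range_succ, mul_add, ih,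
          show m + 1 + L = m + L + 1 by ring, show m + (L + 1) = m + L + 1 by ring,
          Nat.choose_succ_succ]
        push_cast
        ring
    refine ⟨g - (1 - y) ^ (m + 1) * ((m + L).choose (m + 1) : R), ?_⟩
    rw [pow_succ, mul_assoc, h, mul_sub, hg]
    ring

theorem one_sub_pow_mul_sum_choose {R : Type*} [CommRing R] (y : R) (m L : ℕ) :
    ∃ g : R, (1 - y) ^ (m + 1) * ∑ i ∈ Finset.range L, (i.choose m : R) * y ^ i =
      y ^ m + y ^ L * g := by
  induction m with
  | zero =>
    refine ⟨-1, ?_⟩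
    have := mul_neg_geom_sum y L
    simp only [zero_add, Nat.choose_zero_right, Nat.cast_one, one_mul, pow_one]
    rw [this]; ring
  | succ m ih =>
    obtain ⟨g, hg⟩ := ih
    have h : (1 - y) * ∑ i ∈ Finset.range L, (i.choose (m + 1) : R) * y ^ i =
        y * ∑ i ∈ Finset.range L, (i.choose m : R) * y ^ i - (L.choose (m + 1) : R) * y ^ L := by
      clear hg
      induction L with
      | zero => simp
      | succ L ih =>
        rw [Finset.sum_range_succ, Finset.sum_range_succ, mul_add, ih, Nat.choose_succ_succ]
        push_cast
        ring
    refine ⟨y * g - (1 - y) ^ (m + 1) * (L.choose (m + 1) : R), ?_⟩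
    rw [pow_succ, mul_assoc, h, mul_sub, mul_left_comm, hg]
    ring

/-- The power series `(1 - X ^ 4) ^ (-(n + 1))`, as a unit. -/
noncomputable def invUnit (n : ℕ) : (ℝ⟦X⟧)ˣ :=
  (unitOneAddX * unitOneSubX * unitOneAddXSq) ^ (-(n : ℤ) - 1)

theorem exists_invUnit_eq (n : ℕ) :
    ∃ g : ℝ⟦X⟧, (invUnit n : ℝ⟦X⟧) =
      ∑ l ∈ Finset.range (n + 1), C ((n + l).choose n : ℝ) * X ^ (4 * l) + X ^ (n + 1) * g := by
  obtain ⟨g, hg⟩ := one_sub_pow_mul_sum_choose_add (X ^ 4 : ℝ⟦X⟧) n (n + 1)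
  have hu : ((1 - X ^ 4 : ℝ⟦X⟧)) ^ (n + 1) =
      (((unitOneAddX * unitOneSubX * unitOneAddXSq) ^ (n + 1) : (ℝ⟦X⟧)ˣ) : ℝ⟦X⟧) := by
    simp only [Units.val_pow_eq_pow_val, Units.val_mul, val_unitOneAddX, val_unitOneSubX,
      val_unitOneAddXSq]
    congr 1
    ring
  have hinv : (invUnit n : ℝ⟦X⟧) * (1 - X ^ 4) ^ (n + 1) = 1 := by
    rw [hu, ← Units.val_mul, invUnit, ← zpow_natCast, ← zpow_add]
    simp
  refine ⟨- (invUnit n : ℝ⟦X⟧) * X ^ (3 * (n + 1)) * g, ?_⟩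
  have h2 := congrArg (fun z => (invUnit n : ℝ⟦X⟧) * z) hg
  simp only [← mul_assoc, hinv, one_mul] at h2
  have : ∑ l ∈ Finset.range (n + 1), C ((n + l).choose n : ℝ) * X ^ (4 * l) =
      ∑ i ∈ Finset.range (n + 1), (((n + i).choose n : ℕ) : ℝ⟦X⟧) * (X ^ 4) ^ i := by
    refine Finset.sum_congr rfl fun l _ => ?_
    rw [map_natCast, pow_mul]
  rw [this, h2]
  ring

theorem coeff_invUnit_mul {n k : ℕ} (hk : k ≤ n) (f : ℝ⟦X⟧) :
    coeff k ((invUnit n : ℝ⟦X⟧) * f) = ∑ l ∈ Finset.range (n + 1),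
      if 4 * l ≤ k then ((n + l).choose n : ℝ) * coeff (k - 4 * l) f else 0 := by
  obtain ⟨g, hg⟩ := exists_invUnit_eq n
  rw [hg, add_mul, map_add, mul_assoc, coeff_X_pow_mul', if_neg (by omega), add_zero,
    Finset.sum_mul, map_sum]
  refine Finset.sum_congr rfl fun l _ => ?_
  rw [mul_assoc, coeff_C_mul, coeff_X_pow_mul', mul_ite, mul_zero]

theorem choose_mul_coeff_one_add_X_pow_mul_one_sub_X_pow {N b i : ℕ} (hb : b ≤ N) (hi : i ≤ N) :
    (N.choose b : ℝ) * coeff i ((1 + X : ℝ⟦X⟧) ^ b * (1 - X) ^ (N - b)) =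
      (-1) ^ i * (N.choose i : ℝ) * coeff b ((1 + X : ℝ⟦X⟧) ^ (N - i) * (1 - X) ^ i) := by
  have hcoe : ∀ k l : ℕ, (1 + X : ℝ⟦X⟧) ^ k * (1 - X) ^ l =
      (((1 + Polynomial.X) ^ k * (1 - Polynomial.X) ^ l : Polynomial ℝ) : ℝ⟦X⟧) := by
    intro k l
    simp
  rw [hcoe, hcoe, Polynomial.coeff_coe, Polynomial.coeff_coe]
  exact choose_mul_coeff_one_add_pow_mul_one_sub_pow hb hi

/-- The numerator of the generating function whose quotient by `(1 - X ^ 4) ^ (n + 1)` yields the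
row operations `rowCoeff`. -/
noncomputable def numerator (n : ℕ) : ℝ⟦X⟧ :=
  ∑ l ∈ Finset.range (n + 1), if 4 * l ≤ n then
    C (((n + l).choose n : ℝ) * ((6 * n + 4).choose (n - 4 * l) : ℝ)) *
      ((1 + X) ^ (n - 4 * l) * (1 - X) ^ (6 * n + 4 - (n - 4 * l))) else 0

theorem invUnit_mul_eq_kernelUnit (n : ℕ) {a b : ℤ} (hab : a + b = 6 * n + 4) :
    invUnit n * (unitOneAddX ^ a * unitOneSubX ^ b) = kernelUnit n (a - n - 1) := by
  rw [invUnit, mul_zpow, mul_zpow, kernelUnit, show a - n - 1 = a + (-(n : ℤ) - 1) by ring,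
    show 4 * (n : ℤ) + 2 - (a + (-(n : ℤ) - 1)) = b + (-(n : ℤ) - 1) by linarith, zpow_add,
    zpow_add]
  apply Units.ext
  simp only [Units.val_mul]
  ring

theorem coeff_numerator {n i : ℕ} (hi : i ≤ n) :
    coeff i (numerator n) = (-1) ^ i * ((6 * n + 4).choose i : ℝ) *
      (8 ^ n * realBinom ((5 * (n : ℝ) - i) / 4) n) := by
  have hk : ((invUnit n : (ℝ⟦X⟧)ˣ) : ℝ⟦X⟧) * ((1 + X) ^ (6 * n + 4 - i) * (1 - X) ^ i) =
      (kernelUnit n (5 * n + 3 - i) : ℝ⟦X⟧) := by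
    have h := invUnit_mul_eq_kernelUnit n (a := ((6 * n + 4 - i : ℕ) : ℤ)) (b := (i : ℤ))
      (by omega)
    rw [zpow_natCast, zpow_natCast] at h
    rw [← val_unitOneAddX, ← val_unitOneSubX, ← Units.val_pow_eq_pow_val,
      ← Units.val_pow_eq_pow_val, ← Units.val_mul, ← Units.val_mul, h]
    congr 2
    omega
  have h1 := coeff_kernelUnit n (5 * n + 3 - i)
  rw [← hk, coeff_invUnit_mul le_rfl] at h1
  rw [show (5 * (n : ℝ) - i) / 4 = (((5 * n + 3 - i : ℤ) : ℝ) - 3) / 4 by push_cast; ring, ← h1,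
    numerator, map_sum, Finset.mul_sum]
  refine Finset.sum_congr rfl fun l _ => ?_
  split_ifs with hl
  · rw [coeff_C_mul, mul_assoc, choose_mul_coeff_one_add_X_pow_mul_one_sub_X_pow (by omega)
      (by omega)]
    ring
  · simp

theorem coeff_invUnit_mul_numerator_mul (n j : ℕ) :
    coeff n ((invUnit n : ℝ⟦X⟧) * numerator n *
        ((unitOneAddX ^ (4 * (j + 1)) * unitOneSubX ^ (-(4 * (j + 1) : ℤ)) : (ℝ⟦X⟧)ˣ) : ℝ⟦X⟧)) =
      8 ^ n * ∑ l ∈ Finset.range (n + 1), if 4 * l ≤ n then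
        ((n + l).choose n : ℝ) * ((6 * n + 4).choose (n - 4 * l) : ℝ) *
          realBinom ((j : ℝ) - l) n else 0 := by
  rw [mul_comm (invUnit n : ℝ⟦X⟧), mul_assoc, ← Units.val_mul, numerator, Finset.sum_mul, map_sum,
    Finset.mul_sum]
  refine Finset.sum_congr rfl fun l _ => ?_
  split_ifs with hl
  · rw [mul_assoc, coeff_C_mul, ← val_unitOneAddX, ← val_unitOneSubX, ← Units.val_pow_eq_pow_val,
      ← Units.val_pow_eq_pow_val, ← Units.val_mul, ← Units.val_mul]
    have : (unitOneAddX ^ (n - 4 * l) * unitOneSubX ^ (6 * n + 4 - (n - 4 * l)) *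
        (invUnit n * (unitOneAddX ^ (4 * (j + 1)) * unitOneSubX ^ (-(4 * (j + 1) : ℤ)))) :
          (ℝ⟦X⟧)ˣ) = kernelUnit n (4 * j + 3 - 4 * l) := by
      rw [show (4 * j + 3 - 4 * l : ℤ) = ((n - 4 * l : ℕ) : ℤ) + ((4 * (j + 1) : ℕ) : ℤ) - n - 1 by
        push_cast [hl]; ring, ← invUnit_mul_eq_kernelUnit n
          (b := ((6 * n + 4 - (n - 4 * l) : ℕ) : ℤ) + (-(4 * (j + 1) : ℤ))) (by omega),
        zpow_add, zpow_add, zpow_natCast, zpow_natCast, zpow_natCast]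
      ac_rfl
    rw [this, coeff_kernelUnit]
    push_cast
    rw [show (4 * (j : ℝ) + 3 - 4 * l - 3) / 4 = (j : ℝ) - l by ring]
    ring
  · simp

theorem coeff_invUnit_mul_numerator_mul_X_pow (n j : ℕ) :
    coeff n ((invUnit n : ℝ⟦X⟧) * numerator n * X ^ (4 * (j + 1))) =
      8 ^ n * ∑ l ∈ Finset.range (n + 1), if 4 * (l + (j + 1)) ≤ n then
        ((n + l).choose n : ℝ) * ((6 * n + 4).choose (n - 4 * (l + (j + 1))) : ℝ) *
          ((-1) ^ n * realBinom ((n : ℝ) + l + (j + 1)) n) else 0 := by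
  rw [mul_comm, coeff_X_pow_mul']
  split_ifs with hj
  · rw [coeff_invUnit_mul (by omega), Finset.mul_sum]
    refine Finset.sum_congr rfl fun l _ => ?_
    by_cases hl : 4 * (l + (j + 1)) ≤ n
    · rw [if_pos (by omega), if_pos hl, coeff_numerator (by omega),
        show n - 4 * (j + 1) - 4 * l = n - 4 * (l + (j + 1)) by omega]
      have hs : (-1 : ℝ) ^ (n - 4 * (l + (j + 1))) = (-1) ^ n := by
        conv_rhs => rw [show n = n - 4 * (l + (j + 1)) + 2 * (2 * (l + (j + 1))) by omega, pow_add,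
          pow_mul _ 2]
        simp
      rw [hs, Nat.cast_sub hl, show (5 * (n : ℝ) - (n - ((4 * (l + (j + 1)) : ℕ) : ℝ))) / 4 =
        (n : ℝ) + l + (j + 1) by push_cast; ring]
      ring
    · rw [if_neg (by omega), if_neg hl, mul_zero]
  · rw [Finset.sum_eq_zero, mul_zero]
    intro l _
    rw [if_neg (by omega)]

theorem realBinom_natCast (m n : ℕ) : realBinom m n = (m.choose n : ℝ) := by
  rw [realBinom, Nat.cast_choose_eq_descPochhammer_div, descPochhammer_eval_eq_prod_range]

theorem realBinom_neg (c : ℝ) (n : ℕ) : realBinom (-c - 1) n = (-1) ^ n * realBinom (n + c) n := by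
  rw [realBinom, realBinom, ← mul_div_assoc]
  congr 1
  rw [← Finset.prod_range_reflect (fun k => (n : ℝ) + c - (k : ℝ)), ← Finset.card_range n,
    ← Finset.prod_const, Finset.card_range, ← Finset.prod_mul_distrib]
  refine Finset.prod_congr rfl fun k hk => ?_
  rw [Finset.mem_range] at hk
  rw [Nat.sub_sub, Nat.cast_sub (by omega)]
  push_cast
  ring

theorem coeff_telescope {n j : ℕ} (hj : j ≤ n) :
    coeff n ((invUnit n : ℝ⟦X⟧) * numerator n *
        (((unitOneAddX ^ (4 * (j + 1)) * unitOneSubX ^ (-(4 * (j + 1) : ℤ)) : (ℝ⟦X⟧)ˣ) : ℝ⟦X⟧) -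
          X ^ (4 * (j + 1)))) =
      if j = n then 8 ^ n * ((6 * n + 4).choose n : ℝ) else 0 := by
  set g : ℕ → ℝ := fun l => if 4 * l ≤ n then
    ((n + l).choose n : ℝ) * ((6 * n + 4).choose (n - 4 * l) : ℝ) else 0 with hg
  rw [mul_sub, map_sub, coeff_invUnit_mul_numerator_mul, coeff_invUnit_mul_numerator_mul_X_pow,
    ← mul_sub]
  have h1 : (∑ l ∈ Finset.range (n + 1), if 4 * l ≤ n then
        ((n + l).choose n : ℝ) * ((6 * n + 4).choose (n - 4 * l) : ℝ) *
          realBinom ((j : ℝ) - l) n else 0) =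
      ∑ l ∈ Finset.range (n + 1), g l * realBinom ((j : ℝ) - l) n := by
    refine Finset.sum_congr rfl fun l _ => ?_
    simp only [hg, ite_mul, zero_mul]
  have h2 : (∑ l ∈ Finset.range (n + 1), if 4 * (l + (j + 1)) ≤ n then
        ((n + l).choose n : ℝ) * ((6 * n + 4).choose (n - 4 * (l + (j + 1))) : ℝ) *
          ((-1) ^ n * realBinom ((n : ℝ) + l + (j + 1)) n) else 0) =
      ∑ l ∈ Finset.range (n - j), g (j + 1 + l) * realBinom ((j : ℝ) - (j + 1 + l : ℕ)) n := by
    symm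
    apply Finset.sum_subset_zero_on_sdiff (Finset.range_subset_range.mpr (by omega))
    · intro l hl
      simp only [Finset.mem_sdiff, Finset.mem_range] at hl
      rw [if_neg (by omega)]
    · intro l _
      simp only [hg]
      rw [add_comm (j + 1) l]
      split_ifs with h
      · rw [show (j : ℝ) - (l + (j + 1) : ℕ) = -(l : ℝ) - 1 by push_cast; ring, realBinom_neg,
          show (n : ℝ) + l + (j + 1) = ((n + (l + (j + 1)) : ℕ) : ℝ) by push_cast; ring,
          realBinom_natCast, show (n : ℝ) + l = ((n + l : ℕ) : ℝ) by push_cast; ring,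
          realBinom_natCast]
        ring
      · rw [zero_mul]
  rw [h1, h2, show n + 1 = j + 1 + (n - j) by omega, Finset.sum_range_add, add_sub_cancel_right]
  have h3 : ∀ l ∈ Finset.range (j + 1), g l * realBinom ((j : ℝ) - l) n =
      g l * ((j - l).choose n : ℝ) := by
    intro l hl
    rw [Finset.mem_range] at hl
    rw [← Nat.cast_sub (by omega : l ≤ j), realBinom_natCast]
  rw [Finset.sum_congr rfl h3]
  split_ifs with hjn
  · subst hjn
    rw [Finset.sum_eq_single 0]
    · simp [hg]
    · intro l hl hl0
      rw [Finset.mem_range] at hl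
      rw [Nat.choose_eq_zero_of_lt (by omega), Nat.cast_zero, mul_zero]
    · simp
  · rw [Finset.sum_eq_zero, mul_zero]
    intro l _
    rw [Nat.choose_eq_zero_of_lt (by omega), Nat.cast_zero, mul_zero]

/-- The entry of the matrix in row `i` and column `j`, as a function of `i` and `m = 4 * j + 3`. -/
noncomputable def rowEntry (i m : ℕ) : ℝ :=
  2 ^ i * ((m + i).choose m : ℝ) + if i = 0 then 1 else -((i - 1).choose m : ℝ)

theorem exists_telescope_eq (n m : ℕ) :
    ∃ g : ℝ⟦X⟧,
      ((unitOneAddX ^ (m + 1) * unitOneSubX ^ (-(m + 1 : ℤ)) : (ℝ⟦X⟧)ˣ) : ℝ⟦X⟧) - X ^ (m + 1) =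
        1 + ∑ i ∈ Finset.range n, C (rowEntry (i + 1) m) *
          (X * ((unitOneAddX⁻¹ : (ℝ⟦X⟧)ˣ) : ℝ⟦X⟧)) ^ (i + 1) + X ^ (n + 1) * g := by
  set q : ℝ⟦X⟧ := ((unitOneAddX⁻¹ : (ℝ⟦X⟧)ˣ) : ℝ⟦X⟧) with hq
  set t : ℝ⟦X⟧ := ((unitOneSubX⁻¹ : (ℝ⟦X⟧)ˣ) : ℝ⟦X⟧) with ht
  have hq1 : (1 + X) * q = 1 := unitOneAddX.mul_inv
  have ht1 : (1 - X) * t = 1 := unitOneSubX.mul_inv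
  obtain ⟨g₁, hg₁⟩ := one_sub_pow_mul_sum_choose_add (2 * (X * q)) m (n + 1)
  obtain ⟨g₂, hg₂⟩ := one_sub_pow_mul_sum_choose (X * q) m n
  have e1 : (1 - 2 * (X * q)) = (1 - X) * q := by linear_combination -hq1
  have e2 : 1 - X * q = q := by linear_combination -hq1
  rw [e1] at hg₁
  rw [e2] at hg₂
  have hval : ((unitOneAddX ^ (m + 1) * unitOneSubX ^ (-(m + 1 : ℤ)) : (ℝ⟦X⟧)ˣ) : ℝ⟦X⟧) =
      (1 + X) ^ (m + 1) * t ^ (m + 1) := by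
    rw [Units.val_mul, zpow_neg, show ((m : ℤ) + 1) = ((m + 1 : ℕ) : ℤ) by push_cast; rfl,
      zpow_natCast, ← inv_pow, Units.val_pow_eq_pow_val, Units.val_pow_eq_pow_val, val_unitOneAddX]
  have hqp : (1 + X) ^ (m + 1) * q ^ (m + 1) = 1 := by rw [← mul_pow, hq1, one_pow]
  have htp : (1 - X) ^ (m + 1) * t ^ (m + 1) = 1 := by rw [← mul_pow, ht1, one_pow]
  have hsum : 1 + ∑ i ∈ Finset.range n, C (rowEntry (i + 1) m) * (X * q) ^ (i + 1) =
      ∑ i ∈ Finset.range (n + 1), ((m + i).choose m : ℝ⟦X⟧) * (2 * (X * q)) ^ i -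
        X * q * ∑ i ∈ Finset.range n, (i.choose m : ℝ⟦X⟧) * (X * q) ^ i := by
    rw [Finset.sum_range_succ', Finset.mul_sum, add_sub_right_comm, ← Finset.sum_sub_distrib,
      add_comm]
    congr 1
    · refine Finset.sum_congr rfl fun i _ => ?_
      simp only [rowEntry, Nat.succ_ne_zero, if_false, Nat.add_sub_cancel, map_add, map_mul,
        map_pow, map_neg, map_natCast, map_ofNat, mul_pow]
      ring
    · simp
  set S₁ := ∑ i ∈ Finset.range (n + 1), ((m + i).choose m : ℝ⟦X⟧) * (2 * (X * q)) ^ i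
  set S₂ := ∑ i ∈ Finset.range n, (i.choose m : ℝ⟦X⟧) * (X * q) ^ i
  have f1 : S₁ = (1 + X) ^ (m + 1) * t ^ (m + 1) * (1 + (2 * (X * q)) ^ (n + 1) * g₁) := by
    rw [← hg₁, mul_pow]
    linear_combination (-S₁ * (1 + X) ^ (m + 1) * q ^ (m + 1)) * htp - S₁ * hqp
  have f2 : S₂ = (1 + X) ^ (m + 1) * ((X * q) ^ m + (X * q) ^ n * g₂) := by
    rw [← hg₂]
    linear_combination -S₂ * hqp
  have f3 : (1 + X) ^ (m + 1) * (X * q) ^ (m + 1) = X ^ (m + 1) := by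
    rw [mul_pow]
    linear_combination X ^ (m + 1) * hqp
  refine ⟨-(1 + X) ^ (m + 1) * t ^ (m + 1) * (2 * q) ^ (n + 1) * g₁ +
    (1 + X) ^ (m + 1) * q ^ (n + 1) * g₂, ?_⟩
  rw [hsum, hval, f1, f2, ← f3]
  ring

/-- The coefficients of the row operations that make the matrix `rowEntry` upper triangular. -/
noncomputable def rowCoeff (n i : ℕ) : ℝ :=
  if i = 0 then coeff n ((invUnit n : ℝ⟦X⟧) * numerator n) / 2
  else coeff n ((invUnit n : ℝ⟦X⟧) * numerator n *
    (X * ((unitOneAddX⁻¹ : (ℝ⟦X⟧)ˣ) : ℝ⟦X⟧)) ^ i)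

theorem rowCoeff_eq_zero {n i : ℕ} (h : n < i) : rowCoeff n i = 0 := by
  rw [rowCoeff, if_neg (by omega), mul_pow, mul_left_comm, coeff_X_pow_mul', if_neg (by omega)]

theorem rowCoeff_self (n : ℕ) :
    rowCoeff n n = (if n = 0 then 1 / 2 else 1) * (8 ^ n * realBinom (5 * (n : ℝ) / 4) n) := by
  have h0 := coeff_numerator (Nat.zero_le n)
  rw [coeff_zero_eq_constantCoeff_apply] at h0
  have hi : constantCoeff (invUnit n : ℝ⟦X⟧) = 1 := by
    apply constantCoeff_units_zpow
    simp [val_unitOneAddX, val_unitOneSubX, val_unitOneAddXSq]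
  have hq : constantCoeff ((unitOneAddX⁻¹ : (ℝ⟦X⟧)ˣ) : ℝ⟦X⟧) = 1 := by
    rw [← zpow_neg_one]
    exact constantCoeff_units_zpow (by simp [val_unitOneAddX]) _
  rw [rowCoeff]
  split_ifs with hn
  · subst hn
    rw [coeff_zero_eq_constantCoeff_apply, map_mul, hi, h0]
    simp
    ring
  · rw [mul_pow, mul_left_comm, coeff_X_pow_mul', if_pos le_rfl, Nat.sub_self,
      coeff_zero_eq_constantCoeff_apply, map_mul, map_mul, map_pow, hi, hq, h0]
    simp

theorem sum_rowCoeff_mul_rowEntry {n j : ℕ} (hj : j ≤ n) :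
    ∑ i ∈ Finset.range (n + 1), rowCoeff n i * rowEntry i (4 * j + 3) =
      if j = n then 8 ^ n * ((6 * n + 4).choose n : ℝ) else 0 := by
  obtain ⟨g, hg⟩ := exists_telescope_eq n (4 * j + 3)
  have h := coeff_telescope hj
  rw [show 4 * (j + 1) = 4 * j + 3 + 1 by ring,
    show (4 * ((j : ℤ) + 1)) = ((4 * j + 3 : ℕ) : ℤ) + 1 by push_cast; ring, hg, mul_add, mul_add,
    mul_one, Finset.mul_sum, map_add, map_add, map_sum, mul_left_comm, coeff_X_pow_mul',
    if_neg (by omega), add_zero] at h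
  rw [← h, Finset.sum_range_succ', add_comm]
  congr 1
  · simp [rowCoeff, rowEntry]
    ring
  · refine Finset.sum_congr rfl fun i _ => ?_
    rw [rowCoeff, if_neg (Nat.succ_ne_zero i), mul_left_comm, coeff_C_mul, mul_comm]

theorem det_rowEntry (n : ℕ) :
    (∏ i : Fin n, rowCoeff i i) *
        (Matrix.of fun i j : Fin n => rowEntry i (4 * (j : ℕ) + 3)).det =
      ∏ i : Fin n, (8 ^ (i : ℕ) * ((6 * (i : ℕ) + 4).choose i : ℝ)) := by
  set M : Matrix (Fin n) (Fin n) ℝ := Matrix.of fun i j : Fin n => rowEntry i (4 * (j : ℕ) + 3)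
  set L : Matrix (Fin n) (Fin n) ℝ := Matrix.of fun i j : Fin n => rowCoeff i j
  have hL : L.det = ∏ i : Fin n, rowCoeff i i :=
    Matrix.det_of_isLowerTriangular L fun i j hij => rowCoeff_eq_zero hij
  have hprod : ∀ i j : Fin n, j ≤ i → (L * M) i j =
      if (j : ℕ) = i then 8 ^ (i : ℕ) * ((6 * (i : ℕ) + 4).choose i : ℝ) else 0 := by
    intro i j hij
    rw [← sum_rowCoeff_mul_rowEntry (Fin.le_def.mp hij), Matrix.mul_apply]
    refine (Fin.sum_univ_eq_sum_range (fun k => rowCoeff i k * rowEntry k (4 * (j : ℕ) + 3)) n).trans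
      ?_
    symm
    apply Finset.sum_subset (Finset.range_subset_range.mpr i.2)
    intro k _ hk
    rw [Finset.mem_range, not_lt] at hk
    rw [rowCoeff_eq_zero (by omega), zero_mul]
  rw [← hL, ← Matrix.det_mul, Matrix.det_of_isUpperTriangular]
  · refine Finset.prod_congr rfl fun i _ => ?_
    rw [hprod i i le_rfl, if_pos rfl]
  · intro i j hij
    have hij' : j < i := hij
    rw [hprod i j hij'.le, if_neg (by have := Fin.lt_def.mp hij'; omega)]

theorem realBinom_five_mul_div_four_pos (r : ℕ) : 0 < realBinom (5 * (r : ℝ) / 4) r := by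
  rw [realBinom]
  refine div_pos (Finset.prod_pos fun k hk => ?_) (by positivity)
  rw [Finset.mem_range] at hk
  have : (k : ℝ) < r := by exact_mod_cast hk
  linarith

theorem det_rowEntry_eq_prod {n : ℕ} (hn : 0 < n) :
    (Matrix.of fun i j : Fin n => rowEntry i (4 * (j : ℕ) + 3)).det =
      2 * ∏ r ∈ Finset.range n,
        (((6 * r + 4).choose r : ℝ) / realBinom (5 * (r : ℝ) / 4) r) := by
  have h := det_rowEntry n
  rw [Fin.prod_univ_eq_prod_range (fun i => rowCoeff i i) n,
    Fin.prod_univ_eq_prod_range (fun i => (8 : ℝ) ^ i * ((6 * i + 4).choose i : ℝ)) n] at h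
  simp only [rowCoeff_self] at h
  have hhalf : ∏ r ∈ Finset.range n, (if r = 0 then (1 / 2 : ℝ) else 1) = 1 / 2 := by
    rw [Finset.prod_ite_eq_of_mem' _ _ _ (Finset.mem_range.mpr hn)]
  rw [Finset.prod_mul_distrib, hhalf, Finset.prod_mul_distrib, Finset.prod_mul_distrib] at h
  have h8 : ∏ r ∈ Finset.range n, (8 : ℝ) ^ r ≠ 0 :=
    Finset.prod_ne_zero_iff.mpr fun r _ => by positivity
  have hb : ∏ r ∈ Finset.range n, realBinom (5 * (r : ℝ) / 4) r ≠ 0 :=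
    Finset.prod_ne_zero_iff.mpr fun r _ => (realBinom_five_mul_div_four_pos r).ne'
  rw [Finset.prod_div_distrib, mul_div_assoc', eq_div_iff hb]
  apply mul_left_cancel₀ h8
  linear_combination 2 * h

theorem Gamma_add_natCast {x : ℝ} (hx : 0 < x) (r : ℕ) :
    Real.Gamma (x + r) = (∏ k ∈ Finset.range r, (x + k)) * Real.Gamma x := by
  induction r with
  | zero => simp
  | succ r ih =>
    rw [Finset.prod_range_succ, Nat.cast_succ, ← add_assoc, Real.Gamma_add_one (by positivity), ih]
    ring

theorem Gamma_quotient_eq (r : ℕ) :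
    Real.Gamma (6 * ((1 + r : ℕ) : ℝ) - 1) * Real.Gamma ((((1 + r : ℕ) : ℝ) + 3) / 4)
        / (Real.Gamma (5 * ((1 + r : ℕ) : ℝ)) * Real.Gamma ((5 * ((1 + r : ℕ) : ℝ) - 1) / 4)) =
      ((6 * r + 4).choose r : ℝ) / realBinom (5 * (r : ℝ) / 4) r := by
  have h1 : Real.Gamma (6 * ((1 + r : ℕ) : ℝ) - 1) = ((6 * r + 4).factorial : ℝ) := by
    rw [← Real.Gamma_nat_eq_factorial]
    congr 1
    push_cast
    ring
  have h2 : Real.Gamma (5 * ((1 + r : ℕ) : ℝ)) = ((5 * r + 4).factorial : ℝ) := by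
    rw [← Real.Gamma_nat_eq_factorial]
    congr 1
    push_cast
    ring
  have hx : 0 < (r : ℝ) / 4 + 1 := by positivity
  have h3 : Real.Gamma ((((1 + r : ℕ) : ℝ) + 3) / 4) = Real.Gamma ((r : ℝ) / 4 + 1) := by
    congr 1
    push_cast
    ring
  have h4 : Real.Gamma ((5 * ((1 + r : ℕ) : ℝ) - 1) / 4) =
      (realBinom (5 * (r : ℝ) / 4) r * (r.factorial : ℝ)) * Real.Gamma ((r : ℝ) / 4 + 1) := by
    rw [show (5 * ((1 + r : ℕ) : ℝ) - 1) / 4 = ((r : ℝ) / 4 + 1) + r by push_cast; ring,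
      Gamma_add_natCast hx, realBinom, div_mul_cancel₀ _ (by positivity),
      ← Finset.prod_range_reflect]
    congr 1
    refine Finset.prod_congr rfl fun k hk => ?_
    rw [Finset.mem_range] at hk
    rw [Nat.sub_sub, Nat.cast_sub (by omega)]
    push_cast
    ring
  have hb := (realBinom_five_mul_div_four_pos r).ne'
  have hG := (Real.Gamma_pos_of_pos hx).ne'
  rw [h1, h2, h3, h4, Nat.cast_choose ℝ (by omega : r ≤ 6 * r + 4),
    show 6 * r + 4 - r = 5 * r + 4 by omega]
  field_simp

theorem binom_eq_realBinom (α : ℤ) (p : ℕ) : binom α p = realBinom (α : ℝ) p := rfl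

theorem entry_eq_rowEntry (i j : ℕ) :
    (2 : ℝ) ^ i * binom (4 * (j : ℤ) + (i : ℤ) + 3) (4 * j + 3)
        + binom (4 * (j : ℤ) - (i : ℤ) + 3) (4 * j + 3) = rowEntry i (4 * j + 3) := by
  have h1 : binom (4 * (j : ℤ) + (i : ℤ) + 3) (4 * j + 3) =
      ((4 * j + 3 + i).choose (4 * j + 3) : ℝ) := by
    rw [binom_eq_realBinom, ← realBinom_natCast]
    congr 1
    push_cast
    ring
  rw [rowEntry, h1]
  congr 1
  rw [binom_eq_realBinom]
  split_ifs with hi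
  · subst hi
    rw [show (((4 * (j : ℤ) - ((0 : ℕ) : ℤ) + 3 : ℤ)) : ℝ) = ((4 * j + 3 : ℕ) : ℝ) by
      push_cast; ring, realBinom_natCast, Nat.choose_self, Nat.cast_one]
  · obtain ⟨k, rfl⟩ := Nat.exists_eq_succ_of_ne_zero hi
    rw [show (((4 * (j : ℤ) - ((k.succ : ℕ) : ℤ) + 3 : ℤ)) : ℝ) =
        -((k : ℝ) - ((4 * j + 3 : ℕ) : ℝ)) - 1 by push_cast; ring, realBinom_neg,
      add_sub_cancel, realBinom_natCast, Odd.neg_one_pow ⟨2 * j + 1, by ring⟩, neg_one_mul]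
    rfl

theorem stmt_1 (n : ℕ) (hn : 0 < n) :
    (Matrix.of fun i j : Fin n =>
        (2 : ℝ) ^ (i : ℕ) * binom (4 * ((j : ℕ) : ℤ) + ((i : ℕ) : ℤ) + 3) (4 * (j : ℕ) + 3)
          + binom (4 * ((j : ℕ) : ℤ) - ((i : ℕ) : ℤ) + 3) (4 * (j : ℕ) + 3)).det =
      2 * ∏ i ∈ Finset.Icc 1 n,
          Real.Gamma (6 * (i : ℝ) - 1) * Real.Gamma (((i : ℝ) + 3) / 4)
            / (Real.Gamma (5 * (i : ℝ)) * Real.Gamma ((5 * (i : ℝ) - 1) / 4)) := by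
  simp only [entry_eq_rowEntry]
  rw [det_rowEntry_eq_prod hn]
  congr 1
  rw [← Finset.Ico_add_one_right_eq_Icc, Finset.prod_Ico_eq_prod_range]
  exact Finset.prod_congr (by simp) fun r _ => (Gamma_quotient_eq r).symm
end

section
/- For every positive integer n, the determinant of the n×n matrix whose (i,j)-entry (0 ≤ i,j ≤ n−1) is 2^{j}·binom(2i+j, 2i) + binom(2i−j, 2i) equals 2·2^{n(n−1)} times the product over i = 1 to n of Γ(i)·Γ(2i)·Γ(4i−3)·Γ((3i−1)/2) / (Γ(2i−1)·Γ(3i−1)·Γ(3i−2)·Γ((i+1)/2)). -/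
open scoped BigOperators

/-- `predDoubleFactorial k = (k - 1)‼`, with the convention `(-1)‼ = 1`. -/
def predDoubleFactorial (k : ℕ) : ℕ := (k - 1).doubleFactorial

theorem predDoubleFactorial_add_two (k : ℕ) :
    predDoubleFactorial (k + 2) = (k + 1) * predDoubleFactorial k := by
  cases k with
  | zero => rfl
  | succ k => exact Nat.doubleFactorial_add_two k

theorem predDoubleFactorial_pos (k : ℕ) : 0 < predDoubleFactorial k :=
  Nat.doubleFactorial_pos _

/-- The leading even-part value of `weightedSubst (σ + 1) (orthPoly (m + 1) σ)`. -/
noncomputable def pivotSucc (m σ : ℕ) : ℝ :=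
  ((σ + 4 * m + 2).factorial * (σ + 2 * m + 1).factorial : ℝ) /
    (predDoubleFactorial (2 * m + 2) * (σ + 3 * m + 2).factorial *
      predDoubleFactorial (σ + m) * (σ + 3 * m).doubleFactorial)

/-- The leading even-part value of `weightedSubst (σ + 1) (orthPoly n σ)`. -/
noncomputable def pivot : ℕ → ℕ → ℝ
  | 0, _ => 1
  | m + 1, σ => pivotSucc m σ

/-- The coefficient of `X` in `orthPoly (m + 1) σ`. -/
noncomputable def linCoeff (m σ : ℕ) : ℝ :=
  (-1) ^ m * (predDoubleFactorial (2 * m) * σ.factorial * (σ + 2 * m + 1).factorial : ℝ) /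
    ((σ + m + 1).factorial * predDoubleFactorial (σ + m) * (σ + 3 * m).doubleFactorial)

theorem pivotSucc_pos (m σ : ℕ) : 0 < pivotSucc m σ := by
  have h1 := predDoubleFactorial_pos (2 * m + 2)
  have h2 := predDoubleFactorial_pos (σ + m)
  have h3 := Nat.doubleFactorial_pos (σ + 3 * m)
  unfold pivotSucc
  positivity

theorem pivot_pos (n σ : ℕ) : 0 < pivot n σ := by
  cases n with
  | zero => exact one_pos
  | succ m => exact pivotSucc_pos m σ

theorem linCoeff_ne_zero (m σ : ℕ) : linCoeff m σ ≠ 0 := by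
  have h1 := predDoubleFactorial_pos (2 * m)
  have h2 := predDoubleFactorial_pos (σ + m)
  have h3 := Nat.doubleFactorial_pos (σ + 3 * m)
  unfold linCoeff
  positivity

theorem linCoeff_succ_mul_pivotSucc (m σ : ℕ) :
    linCoeff (m + 1) σ * pivotSucc m σ =
      linCoeff m (σ + 1) * pivotSucc m σ - pivotSucc m (σ + 1) * linCoeff m σ := by
  have e1 : σ + 2 * (m + 1) + 1 = σ + 2 * m + 1 + 1 + 1 := by ring
  have e3 : σ + (m + 1) = σ + m + 1 := by ring
  have e4 : σ + 3 * (m + 1) = σ + 3 * m + 1 + 2 := by ring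
  have e5 : σ + 1 + 2 * m + 1 = σ + 2 * m + 1 + 1 := by ring
  have e7 : σ + 1 + m = σ + m + 1 := by ring
  have e8 : σ + 1 + 3 * m = σ + 3 * m + 1 := by ring
  have e9 : σ + 1 + 4 * m + 2 = σ + 4 * m + 2 + 1 := by ring
  have e10 : σ + 3 * m + 1 + 2 = σ + 3 * m + 2 + 1 := by ring
  have h1 := (predDoubleFactorial_pos (2 * m)).ne'
  have h2 := (predDoubleFactorial_pos (σ + m)).ne'
  have h3 := (Nat.doubleFactorial_pos (σ + 3 * m)).ne'
  have h4 := (predDoubleFactorial_pos (σ + m + 1)).ne'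
  have h5 := (Nat.doubleFactorial_pos (σ + 3 * m + 1)).ne'
  simp only [linCoeff, pivotSucc, e1, e3, e4, e5, e7, e8, e9]
  rw [Nat.doubleFactorial_add_two (σ + 3 * m + 1), e10,
    Nat.factorial_succ (σ + 2 * m + 1 + 1), Nat.factorial_succ (σ + 2 * m + 1),
    Nat.factorial_succ (σ + m + 1), Nat.factorial_succ (σ + 4 * m + 2),
    Nat.factorial_succ (σ + 3 * m + 2), Nat.factorial_succ σ, Nat.mul_succ 2 m,
    predDoubleFactorial_add_two (2 * m)]
  push_cast
  field_simp
  ring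

theorem pivotSucc_recurrence (m σ : ℕ) :
    pivotSucc (m + 1) (σ + 1) * linCoeff (m + 1) σ =
      pivotSucc m (σ + 4) * linCoeff (m + 1) σ +
        linCoeff (m + 1) (σ + 1) * pivotSucc (m + 1) σ := by
  have e1 : σ + 2 * (m + 1) + 1 = σ + 2 * m + 3 := by ring
  have e3 : σ + (m + 1) = σ + m + 1 := by ring
  have e4 : σ + 3 * (m + 1) = σ + 3 * m + 1 + 2 := by ring
  have e5 : σ + 1 + 2 * (m + 1) + 1 = σ + 2 * m + 3 + 1 := by ring
  have e7 : σ + 1 + (m + 1) = σ + m + 2 := by ring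
  have e8 : σ + 1 + 3 * (m + 1) = σ + 3 * m + 2 + 2 := by ring
  have e9 : σ + 1 + 4 * (m + 1) + 2 = σ + 4 * m + 6 + 1 := by ring
  have e11 : σ + 4 * (m + 1) + 2 = σ + 4 * m + 6 := by ring
  have e12 : σ + 3 * m + 1 + 2 + 2 = σ + 3 * m + 5 := by ring
  have e13 : σ + 4 + 4 * m + 2 = σ + 4 * m + 6 := by ring
  have e14 : σ + 4 + 2 * m + 1 = σ + 2 * m + 3 + 1 + 1 := by ring
  have e16 : σ + 4 + m = σ + m + 2 + 2 := by ring
  have e17 : σ + 4 + 3 * m = σ + 3 * m + 2 + 2 := by ring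
  have h1 := (predDoubleFactorial_pos (2 * m)).ne'
  have h2 := (predDoubleFactorial_pos (σ + m)).ne'
  have h3 := (Nat.doubleFactorial_pos (σ + 3 * m + 1)).ne'
  have h4 := (predDoubleFactorial_pos (σ + m + 1)).ne'
  have h5 := (Nat.doubleFactorial_pos (σ + 3 * m + 2)).ne'
  simp only [linCoeff, pivotSucc, e1, e3, e5, e7, e8, e9, e11, e13, e14, e16, e17]
  simp only [e4, e12]
  rw [Nat.factorial_succ (σ + 2 * m + 3 + 1), Nat.factorial_succ (σ + 2 * m + 3),
    Nat.factorial_succ (σ + m + 2), Nat.factorial_succ (σ + 4 * m + 6),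
    Nat.factorial_succ (σ + 3 * m + 5), Nat.factorial_succ σ, Nat.mul_succ 2 m,
    Nat.doubleFactorial_add_two (σ + 3 * m + 1), Nat.doubleFactorial_add_two (σ + 3 * m + 2),
    predDoubleFactorial_add_two (σ + m + 2), predDoubleFactorial_add_two (σ + m),
    predDoubleFactorial_add_two (2 * m + 2), predDoubleFactorial_add_two (2 * m)]
  push_cast
  field_simp
  ring

theorem factorial_eq_doubleFactorial_mul_pred (k : ℕ) :
    k.factorial = k.doubleFactorial * predDoubleFactorial k := by
  cases k with
  | zero => rfl
  | succ k => exact Nat.factorial_eq_mul_doubleFactorial k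

theorem pivotSucc_zero (σ : ℕ) : pivotSucc 0 σ = σ + 1 := by
  have h1 : predDoubleFactorial 2 = 1 := rfl
  have h2 := (predDoubleFactorial_pos σ).ne'
  have h3 := (Nat.doubleFactorial_pos σ).ne'
  simp only [pivotSucc, mul_zero, add_zero, zero_add, h1]
  rw [Nat.factorial_succ σ, factorial_eq_doubleFactorial_mul_pred σ]
  push_cast
  field_simp

theorem linCoeff_zero (σ : ℕ) : linCoeff 0 σ = 1 := by
  have h1 : predDoubleFactorial 0 = 1 := rfl
  have h2 := (predDoubleFactorial_pos σ).ne'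
  have h3 := (Nat.doubleFactorial_pos σ).ne'
  simp only [linCoeff, mul_zero, add_zero, h1]
  rw [factorial_eq_doubleFactorial_mul_pred σ]
  push_cast
  field_simp

theorem pivotSucc_succ_zero (m : ℕ) : pivotSucc (m + 1) 0 = pivotSucc m 3 := by
  have e1 : 0 + 4 * (m + 1) + 2 = 4 * m + 5 + 1 := by ring
  have e2 : 0 + 2 * (m + 1) + 1 = 2 * m + 3 := by ring
  have e3 : 2 * (m + 1) + 2 = 2 * m + 2 + 2 := by ring
  have e5 : 0 + (m + 1) = m + 1 := by ring
  have e6 : 0 + 3 * (m + 1) = 3 * m + 3 := by ring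
  have e7 : 3 + 4 * m + 2 = 4 * m + 5 := by ring
  have e8 : 3 + 2 * m + 1 = 2 * m + 3 + 1 := by ring
  have e10 : 3 + m = m + 1 + 2 := by ring
  have e11 : 3 + 3 * m = 3 * m + 3 := by ring
  have h1 := (predDoubleFactorial_pos (2 * m + 2)).ne'
  have h2 := (predDoubleFactorial_pos (m + 1)).ne'
  have h3 := (Nat.doubleFactorial_pos (3 * m + 3)).ne'
  simp only [pivotSucc, e1, e2, e3, e5, e6, e7, e8, e10, e11]
  rw [Nat.factorial_succ (4 * m + 5), Nat.factorial_succ (2 * m + 3),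
    predDoubleFactorial_add_two (2 * m + 2), predDoubleFactorial_add_two (m + 1)]
  push_cast
  field_simp
  ring

theorem pivot_one_step (n : ℕ) : pivot (n + 1) 0 = pivot n 3 := by
  cases n with
  | zero => simp [pivot, pivotSucc_zero]
  | succ m => exact pivotSucc_succ_zero m

theorem pivot_recurrence (n σ : ℕ) :
    pivot (n + 1) (σ + 1) =
      pivot n (σ + 4) + linCoeff n (σ + 1) / linCoeff n σ * pivot (n + 1) σ := by
  cases n with
  | zero => simp [pivot, pivotSucc_zero, linCoeff_zero]; ring
  | succ m =>
    have h := pivotSucc_recurrence m σ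
    have h0 := linCoeff_ne_zero (m + 1) σ
    simp only [pivot]
    field_simp
    linear_combination h

theorem Gamma_ratio (k j : ℕ) :
    Real.Gamma (((k + 2 * j : ℕ) + 2 : ℝ) / 2) * 2 ^ j * k.doubleFactorial =
      (k + 2 * j).doubleFactorial * Real.Gamma (((k : ℝ) + 2) / 2) := by
  induction j with
  | zero => simp [mul_comm]
  | succ j ih =>
    have e : k + 2 * (j + 1) = k + 2 * j + 2 := by ring
    have e2 : (((k + 2 * j + 2 : ℕ) : ℝ) + 2) / 2 = ((k + 2 * j : ℕ) + 2 : ℝ) / 2 + 1 := by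
      push_cast; ring
    rw [e, e2, Real.Gamma_add_one (by positivity), Nat.doubleFactorial_add_two, pow_succ]
    push_cast at ih ⊢
    linear_combination ((k : ℝ) + 2 * j + 2) * ih

theorem pivot_two_eq_Gamma (n : ℕ) :
    pivot n 2 = 2 ^ (2 * n) *
      (Real.Gamma (n + 1 : ℝ) * Real.Gamma (2 * (n + 1 : ℝ)) * Real.Gamma (4 * (n + 1 : ℝ) - 3) *
          Real.Gamma ((3 * (n + 1 : ℝ) - 1) / 2) /
        (Real.Gamma (2 * (n + 1 : ℝ) - 1) * Real.Gamma (3 * (n + 1 : ℝ) - 1) *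
          Real.Gamma (3 * (n + 1 : ℝ) - 2) * Real.Gamma (((n + 1 : ℝ) + 1) / 2))) := by
  have g (a : ℝ) (k : ℕ) (h : a = k + 1) : Real.Gamma a = k.factorial := by
    rw [h, Real.Gamma_nat_eq_factorial]
  have hG := Gamma_ratio n n
  have hpos : 0 < Real.Gamma (((n : ℝ) + 2) / 2) := Real.Gamma_pos_of_pos (by positivity)
  have hd := Nat.doubleFactorial_pos n
  rw [g (n + 1) n rfl, g (2 * (n + 1)) (2 * n + 1) (by push_cast; ring),
    g (4 * (n + 1) - 3) (4 * n) (by push_cast; ring),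
    g (2 * (n + 1) - 1) (2 * n) (by push_cast; ring),
    g (3 * (n + 1) - 1) (3 * n + 1) (by push_cast; ring),
    g (3 * (n + 1) - 2) (3 * n) (by push_cast; ring),
    show (3 * (n + 1 : ℝ) - 1) / 2 = ((n + 2 * n : ℕ) + 2 : ℝ) / 2 by push_cast; ring,
    show ((n + 1 : ℝ) + 1) / 2 = ((n : ℝ) + 2) / 2 by ring]
  have hG' : Real.Gamma (((n + 2 * n : ℕ) + 2 : ℝ) / 2) =
      (n + 2 * n).doubleFactorial * Real.Gamma (((n : ℝ) + 2) / 2) /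
        (2 ^ n * n.doubleFactorial) := by
    rw [eq_div_iff (by positivity), ← hG]; ring
  rw [hG']
  cases n with
  | zero => simp [pivot]
  | succ m =>
    simp only [pivot, pivotSucc]
    have e1 : 2 + 4 * m + 2 = 4 * (m + 1) := by ring
    have e2 : 2 + 2 * m + 1 = 2 * (m + 1) + 1 := by ring
    have e3 : 2 + 3 * m + 2 = 3 * (m + 1) + 1 := by ring
    have e4 : 2 + m = m + 2 := by ring
    have e5 : 3 * (m + 1) = 2 + 3 * m + 1 := by ring
    have e6 : m + 1 + 2 * (m + 1) = 3 * (m + 1) := by ring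
    have f1 : (2 * (m + 1)).factorial = 2 ^ (m + 1) * (m + 1).factorial *
        predDoubleFactorial (2 * m + 2) := by
      rw [factorial_eq_doubleFactorial_mul_pred, Nat.doubleFactorial_two_mul]; rfl
    have f2 : (3 * (m + 1)).factorial =
        (3 * (m + 1)).doubleFactorial * (2 + 3 * m).doubleFactorial := by
      rw [e5, Nat.factorial_eq_mul_doubleFactorial]
    have f3 : predDoubleFactorial (m + 2) = (m + 1).doubleFactorial := rfl
    have p1 := Nat.doubleFactorial_pos (3 * (m + 1))
    have p2 := Nat.doubleFactorial_pos (2 + 3 * m)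
    have p3 := predDoubleFactorial_pos (2 * m + 2)
    rw [e1, e2, e3, e4, e6, f1, f2, f3]
    push_cast at hpos ⊢
    field_simp
    ring

/-- The even-indexed coefficients of `f` vanish below index `2 * m`, where the coefficient is `h`. -/
def EvenLead (m : ℕ) (h : ℝ) (f : PowerSeries ℝ) : Prop :=
  (∀ i < m, PowerSeries.coeff (2 * i) f = 0) ∧ PowerSeries.coeff (2 * m) f = h

namespace EvenLead

open PowerSeries

variable {m : ℕ} {h h' : ℝ} {f f' : PowerSeries ℝ}

theorem sub (hf : EvenLead m h f) (hf' : EvenLead m h' f') : EvenLead m (h - h') (f - f') :=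
  ⟨fun i hi => by rw [map_sub, hf.1 i hi, hf'.1 i hi, sub_zero], by rw [map_sub, hf.2, hf'.2]⟩

theorem smul (c : ℝ) (hf : EvenLead m h f) : EvenLead m (c * h) (c • f) :=
  ⟨fun i hi => by simp [hf.1 i hi], by simp [hf.2]⟩

theorem succ (hf : EvenLead m 0 f) : EvenLead (m + 1) (coeff (2 * (m + 1)) f) f :=
  ⟨fun i hi => (Nat.lt_succ_iff_lt_or_eq.1 hi).elim (hf.1 i) fun e => e ▸ hf.2, rfl⟩

theorem coeff_two_mul_one_add (c : ℝ) (f : PowerSeries ℝ) (i : ℕ) :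
    coeff (2 * i) ((1 + c • X ^ 2) * f) =
      coeff (2 * i) f + c * if i = 0 then 0 else coeff (2 * (i - 1)) f := by
  rw [add_mul, one_mul, smul_mul_assoc, map_add, coeff_smul, coeff_X_pow_mul', smul_eq_mul]
  rcases i with _ | i
  · simp
  · simp [show 2 ≤ 2 * (i + 1) by omega, show 2 * (i + 1) - 2 = 2 * i by omega]

theorem one_add_mul_iff (c : ℝ) : EvenLead m h ((1 + c • X ^ 2) * f) ↔ EvenLead m h f := by
  constructor
  · intro hf
    have key : ∀ i < m, coeff (2 * i) f = 0 := by
      intro i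
      induction i with
      | zero =>
        intro hi
        have := hf.1 0 hi
        rw [coeff_two_mul_one_add] at this
        simpa using this
      | succ i ih =>
        intro hi
        have := hf.1 _ hi
        rw [coeff_two_mul_one_add] at this
        simpa [ih (by omega)] using this
    refine ⟨key, ?_⟩
    have := hf.2
    rw [coeff_two_mul_one_add] at this
    rcases m with _ | m
    · simpa using this
    · simpa [key m (by omega)] using this
  · intro hf
    refine ⟨fun i hi => ?_, ?_⟩
    · rw [coeff_two_mul_one_add, hf.1 i hi]
      rcases i with _ | i
      · simp
      · simp [hf.1 i (by omega)]
    · rw [coeff_two_mul_one_add, hf.2]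
      rcases m with _ | m
      · simp
      · simp [hf.1 m (by omega)]

theorem X_sq_mul_iff : EvenLead (m + 1) h (X ^ 2 * f) ↔ EvenLead m h f := by
  have key (i : ℕ) : coeff (2 * (i + 1)) (X ^ 2 * f) = coeff (2 * i) f := by
    rw [show 2 * (i + 1) = 2 * i + 2 by ring, coeff_X_pow_mul]
  constructor
  · exact fun hf => ⟨fun i hi => by rw [← key]; exact hf.1 _ (by omega), by rw [← key]; exact hf.2⟩
  · refine fun hf => ⟨fun i hi => ?_, by rw [key]; exact hf.2⟩
    rcases i with _ | i
    · simp [coeff_X_pow_mul']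
    · rw [key]; exact hf.1 i (by omega)

end EvenLead

/-- The geometric series `1 / (1 - X)`. -/
noncomputable def geom : PowerSeries ℝ := PowerSeries.mk 1

theorem geom_mul_one_sub : geom * (1 - PowerSeries.X) = 1 :=
  PowerSeries.mk_one_mul_one_sub_eq_one ℝ

/-- The linear map `P ↦ (1 - X) ^ (2 - s) * P (X * (1 + X) / (1 - X))`. -/
noncomputable def weightedSubst (s : ℕ) : Polynomial ℝ →ₗ[ℝ] PowerSeries ℝ :=
  LinearMap.mulLeft ℝ ((1 - PowerSeries.X) ^ 2 * geom ^ s) ∘ₗ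
    (Polynomial.aeval (PowerSeries.X * (1 + PowerSeries.X) * geom)).toLinearMap

theorem weightedSubst_apply (s : ℕ) (P : Polynomial ℝ) :
    weightedSubst s P = (1 - PowerSeries.X) ^ 2 * geom ^ s *
      Polynomial.aeval (PowerSeries.X * (1 + PowerSeries.X) * geom) P := rfl

theorem weightedSubst_one_add_X_mul (s : ℕ) (P : Polynomial ℝ) :
    weightedSubst s ((1 + Polynomial.X) * P) =
      (1 + (1 : ℝ) • PowerSeries.X ^ 2) * weightedSubst (s + 1) P := by
  simp only [weightedSubst_apply, map_mul, map_add, map_one, Polynomial.aeval_X, one_smul]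
  linear_combination (-(1 - PowerSeries.X) ^ 2 * geom ^ s *
    Polynomial.aeval (PowerSeries.X * (1 + PowerSeries.X) * geom) P) * geom_mul_one_sub

theorem weightedSubst_X_sq_mul (s : ℕ) (P : Polynomial ℝ) :
    weightedSubst s (Polynomial.X ^ 2 * P) =
      PowerSeries.X ^ 2 * ((1 + (-1 : ℝ) • PowerSeries.X ^ 2) *
        ((1 + (-1 : ℝ) • PowerSeries.X ^ 2) * weightedSubst (s + 4) P)) := by
  have h : (geom * (1 - PowerSeries.X)) ^ 2 = 1 := by rw [geom_mul_one_sub, one_pow]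
  simp only [weightedSubst_apply, map_mul, map_pow, Polynomial.aeval_X, neg_smul, one_smul]
  linear_combination (-(1 - PowerSeries.X) ^ 2 * geom ^ (s + 2) * PowerSeries.X ^ 2 *
    (1 + PowerSeries.X) ^ 2 *
    Polynomial.aeval (PowerSeries.X * (1 + PowerSeries.X) * geom) P) * h

theorem evenLead_weightedSubst_zero_X (m : ℕ) :
    EvenLead m 0 (weightedSubst 0 Polynomial.X) := by
  have h : weightedSubst 0 Polynomial.X = PowerSeries.X - PowerSeries.X ^ 3 := by
    simp only [weightedSubst_apply, Polynomial.aeval_X, pow_zero, mul_one]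
    linear_combination ((1 - PowerSeries.X) * PowerSeries.X * (1 + PowerSeries.X)) *
      geom_mul_one_sub
  have key (i : ℕ) : PowerSeries.coeff (2 * i) (weightedSubst 0 Polynomial.X) = 0 := by
    rw [h, map_sub, PowerSeries.coeff_X, PowerSeries.coeff_X_pow, if_neg (by omega),
      if_neg (by omega), sub_zero]
  exact ⟨fun i _ => key i, key m⟩

/-- The monic polynomials whose images under `weightedSubst (σ + 1)` have vanishing low-order
even part. -/
noncomputable def orthPoly : ℕ → ℕ → Polynomial ℝ
  | 0, _ => 1
  | n + 1, σ => (1 + Polynomial.X) * orthPoly n (σ + 1) -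
      (pivot n (σ + 1) / pivot n σ) • orthPoly n σ

theorem orthPoly_coeff_of_lt (n : ℕ) : ∀ σ k : ℕ, n < k → (orthPoly n σ).coeff k = 0 := by
  induction n with
  | zero => intro σ k hk; simp [orthPoly, Polynomial.coeff_one, hk.ne']
  | succ n ih =>
    intro σ k hk
    obtain ⟨k, rfl⟩ : ∃ l, k = l + 1 := ⟨k - 1, by omega⟩
    simp [orthPoly, add_mul, Polynomial.coeff_X_mul, ih _ k (by omega), ih _ (k + 1) (by omega)]

theorem orthPoly_coeff_self (n : ℕ) : ∀ σ : ℕ, (orthPoly n σ).coeff n = 1 := by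
  induction n with
  | zero => intro σ; simp [orthPoly]
  | succ n ih =>
    intro σ
    simp [orthPoly, add_mul, Polynomial.coeff_X_mul, ih, orthPoly_coeff_of_lt n _ (n + 1)]

theorem orthPoly_succ_coeff_zero (n : ℕ) : ∀ σ : ℕ, (orthPoly (n + 1) σ).coeff 0 = 0 := by
  induction n with
  | zero => intro σ; simp [orthPoly, pivot]
  | succ n ih =>
    intro σ
    rw [orthPoly]
    simp [add_mul, ih]

theorem orthPoly_succ_coeff_one (n : ℕ) : ∀ σ : ℕ, (orthPoly (n + 1) σ).coeff 1 = linCoeff n σ := by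
  induction n with
  | zero => intro σ; rw [linCoeff_zero]; exact orthPoly_coeff_self 1 σ
  | succ n ih =>
    intro σ
    have h := linCoeff_succ_mul_pivotSucc n σ
    have h0 := (pivotSucc_pos n σ).ne'
    rw [orthPoly]
    have h1 : (Polynomial.X * orthPoly (n + 1) (σ + 1)).coeff 1 = 0 :=
      (Polynomial.coeff_X_mul _ 0).trans (orthPoly_succ_coeff_zero n _)
    simp only [add_mul, one_mul, Polynomial.coeff_sub, Polynomial.coeff_add, ih, pivot,
      Polynomial.coeff_smul, smul_eq_mul, h1]
    field_simp
    linear_combination -h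

theorem eq_zero_of_evenLead {s m : ℕ} {P : ℕ → Polynomial ℝ} {h : ℕ → ℝ}
    (hself : ∀ k < m, (P k).coeff k = 1) (hlt : ∀ k < m, ∀ l, k < l → (P k).coeff l = 0)
    (hlead : ∀ k < m, EvenLead k (h k) (weightedSubst s (P k))) (h0 : ∀ k < m, h k ≠ 0)
    {U : Polynomial ℝ} (hU : ∀ k, m ≤ k → U.coeff k = 0)
    (hvan : ∀ i < m, PowerSeries.coeff (2 * i) (weightedSubst s U) = 0) : U = 0 := by
  induction m generalizing U with
  | zero => ext k; simpa using hU k (Nat.zero_le k)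
  | succ m ih =>
    have hm : U - U.coeff m • P m = 0 := by
      refine ih (fun k hk => hself k (by omega)) (fun k hk => hlt k (by omega))
        (fun k hk => hlead k (by omega)) (fun k hk => h0 k (by omega)) (fun k hk => ?_)
        (fun i hi => ?_)
      · rcases hk.eq_or_lt with rfl | hk
        · simp [hself]
        · simp [hU k hk, hlt m (by omega) k hk]
      · rw [map_sub, map_smul, map_sub, hvan i (by omega), PowerSeries.coeff_smul,
          (hlead m (by omega)).1 i hi]
        simp
    have e : U = U.coeff m • P m := sub_eq_zero.1 hm
    have hz := hvan m (by omega)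
    rw [e, map_smul, PowerSeries.coeff_smul, (hlead m (by omega)).2, smul_eq_mul] at hz
    rw [e, (mul_eq_zero.1 hz).resolve_right (h0 m (by omega)), zero_smul]

theorem evenLead_recurrence {n s : ℕ} {a b b₁ : ℝ} {B : Polynomial ℝ}
    (ih : ∀ k ≤ n, EvenLead k (pivot k (s + 3)) (weightedSubst (s + 4) (orthPoly k (s + 3))))
    (ha : EvenLead (n + 1) a (weightedSubst (s + 1) (orthPoly (n + 1) s)))
    (hb : EvenLead (n + 1) b (weightedSubst s B)) (hB0 : B.coeff 0 = 0) (hB1 : B.coeff 1 = b₁)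
    (hb₁ : b₁ ≠ 0) (hB : ∀ k, n + 1 < k → B.coeff k = 0) :
    a = pivot n (s + 3) + linCoeff n s / b₁ * b := by
  set Q : Polynomial ℝ := (1 + Polynomial.X) * orthPoly (n + 1) s -
    Polynomial.X ^ 2 * orthPoly n (s + 3) - (linCoeff n s / b₁) • B with hQ
  have hQlead : EvenLead (n + 1) (a - pivot n (s + 3) - linCoeff n s / b₁ * b)
      (weightedSubst s Q) := by
    rw [hQ, map_sub, map_sub, map_smul, weightedSubst_one_add_X_mul, weightedSubst_X_sq_mul]
    refine (((EvenLead.one_add_mul_iff 1).2 ha).sub (EvenLead.X_sq_mul_iff.2 ?_)).sub (hb.smul _)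
    exact (EvenLead.one_add_mul_iff _).2 ((EvenLead.one_add_mul_iff _).2 (ih n le_rfl))
  set U := Q.divX.divX with hU
  have hQ0 : Q.coeff 0 = 0 := by
    simp [hQ, orthPoly_succ_coeff_zero, hB0, Polynomial.mul_coeff_zero]
  have hQ1 : Q.coeff 1 = 0 := by
    have h1 : (Polynomial.X * orthPoly (n + 1) s).coeff 1 = 0 :=
      (Polynomial.coeff_X_mul _ 0).trans (orthPoly_succ_coeff_zero n _)
    have h2 : (Polynomial.X ^ 2 * orthPoly n (s + 3)).coeff 1 = 0 := by
      simp [Polynomial.coeff_X_pow_mul']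
    simp [hQ, add_mul, h1, h2, hB1, orthPoly_succ_coeff_one, hb₁]
  have hQU : Q = Polynomial.X ^ 2 * U := by
    ext k
    rcases k with _ | _ | k
    · simp [hQ0]
    · simp [hQ1, Polynomial.coeff_X_pow_mul']
    · simp [hU, Polynomial.coeff_X_pow_mul]
  have hUdeg : ∀ k, n ≤ k → U.coeff k = 0 := by
    intro k hk
    have e1 : (Polynomial.X * orthPoly (n + 1) s).coeff (k + 2) =
        (orthPoly (n + 1) s).coeff (k + 1) :=
      Polynomial.coeff_X_mul _ _
    simp only [hU, Polynomial.coeff_divX, hQ, add_mul, one_mul, Polynomial.coeff_sub,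
      Polynomial.coeff_add, Polynomial.coeff_smul, Polynomial.coeff_X_pow_mul, add_assoc,
      Nat.reduceAdd, e1, orthPoly_coeff_of_lt (n + 1) s (k + 2) (by omega), hB (k + 2) (by omega)]
    rcases hk.eq_or_lt with rfl | hk
    · simp [orthPoly_coeff_self]
    · simp [orthPoly_coeff_of_lt _ _ _ hk, orthPoly_coeff_of_lt (n + 1) _ (k + 1) (by omega)]
  rw [hQU, weightedSubst_X_sq_mul, EvenLead.X_sq_mul_iff, EvenLead.one_add_mul_iff,
    EvenLead.one_add_mul_iff] at hQlead
  have hU0 : U = 0 :=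
    eq_zero_of_evenLead (P := fun k => orthPoly k (s + 3)) (h := fun k => pivot k (s + 3))
      (fun k _ => orthPoly_coeff_self k _) (fun k _ l => orthPoly_coeff_of_lt k _ l)
      (fun k hk => ih k hk.le) (fun k _ => (pivot_pos k _).ne') hUdeg hQlead.1
  have hval := hQlead.2
  rw [hU0, map_zero, map_zero] at hval
  linear_combination -hval

theorem evenLead_orthPoly (n σ : ℕ) :
    EvenLead n (pivot n σ) (weightedSubst (σ + 1) (orthPoly n σ)) := by
  induction n using Nat.strong_induction_on generalizing σ with
  | _ n ih =>
  rcases n with _ | n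
  · refine ⟨fun i hi => absurd hi (Nat.not_lt_zero i), ?_⟩
    simp [weightedSubst_apply, orthPoly, pivot, geom, PowerSeries.coeff_zero_eq_constantCoeff_apply,
      ← PowerSeries.coeff_zero_eq_constantCoeff_apply (PowerSeries.mk 1)]
  have hlead (σ : ℕ) : EvenLead (n + 1)
      (PowerSeries.coeff (2 * (n + 1)) (weightedSubst (σ + 1) (orthPoly (n + 1) σ)))
      (weightedSubst (σ + 1) (orthPoly (n + 1) σ)) := by
    apply EvenLead.succ
    have h := ((EvenLead.one_add_mul_iff 1).2 (ih n n.lt_succ_self (σ + 1))).sub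
      ((ih n n.lt_succ_self σ).smul (pivot n (σ + 1) / pivot n σ))
    rw [div_mul_cancel₀ _ (pivot_pos n σ).ne', sub_self] at h
    rwa [orthPoly, map_sub, map_smul, weightedSubst_one_add_X_mul]
  suffices h : PowerSeries.coeff (2 * (n + 1)) (weightedSubst (σ + 1) (orthPoly (n + 1) σ)) =
      pivot (n + 1) σ from h ▸ hlead σ
  induction σ with
  | zero =>
    rw [evenLead_recurrence (fun k hk => ih k (by omega) 3) (hlead 0)
      (evenLead_weightedSubst_zero_X _) Polynomial.coeff_X_zero Polynomial.coeff_X_one one_ne_zero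
      (fun k hk => Polynomial.coeff_X_of_ne_one (by omega)), mul_zero, add_zero, pivot_one_step]
  | succ σ ihσ =>
    rw [evenLead_recurrence (fun k hk => ih k (by omega) _) (hlead (σ + 1)) (hlead σ)
      (orthPoly_succ_coeff_zero n σ) (orthPoly_succ_coeff_one n σ) (linCoeff_ne_zero n σ)
      (orthPoly_coeff_of_lt (n + 1) σ), ihσ, pivot_recurrence]

/-- Monic up to a factor at index zero, these satisfy
`weightedSubst 3 (pairPoly j) = (2 ^ j / (1 - X) ^ j + (1 - X) ^ j) / (1 - X)`. -/
noncomputable def pairPoly : ℕ → Polynomial ℝ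
  | 0 => 2
  | 1 => 3 + Polynomial.X
  | j + 2 => (3 + Polynomial.X) * pairPoly (j + 1) - 2 * pairPoly j

theorem pairPoly_coeff_of_lt (j : ℕ) : ∀ k, j < k → (pairPoly j).coeff k = 0 := by
  induction j using Nat.twoStepInduction with
  | zero =>
    intro k hk
    obtain ⟨k, rfl⟩ : ∃ l, k = l + 1 := ⟨k - 1, by omega⟩
    simp [pairPoly]
  | one =>
    intro k hk
    obtain ⟨k, rfl⟩ : ∃ l, k = l + 1 := ⟨k - 1, by omega⟩
    simp [pairPoly, Polynomial.coeff_X_of_ne_one hk.ne']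
  | more j ih₀ ih₁ =>
    intro k hk
    obtain ⟨k, rfl⟩ : ∃ l, k = l + 1 := ⟨k - 1, by omega⟩
    simp [pairPoly, add_mul, Polynomial.coeff_X_mul, ih₁ k (by omega), ih₁ (k + 1) (by omega),
      ih₀ (k + 1) (by omega)]

theorem pairPoly_coeff_self (j : ℕ) : (pairPoly (j + 1)).coeff (j + 1) = 1 := by
  induction j with
  | zero => simp [pairPoly]
  | succ j ih =>
    simp [pairPoly, add_mul, Polynomial.coeff_X_mul, ih, pairPoly_coeff_of_lt (j + 1) (j + 2),
      pairPoly_coeff_of_lt j (j + 2)]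

theorem aeval_pairPoly (j : ℕ) :
    Polynomial.aeval (PowerSeries.X * (1 + PowerSeries.X) * geom) (pairPoly j) =
      (2 * geom) ^ j + (1 - PowerSeries.X) ^ j := by
  have h3 : (3 : PowerSeries ℝ) + PowerSeries.X * (1 + PowerSeries.X) * geom =
      2 * geom + (1 - PowerSeries.X) := by
    linear_combination (-2 - PowerSeries.X) * geom_mul_one_sub
  induction j using Nat.twoStepInduction with
  | zero => simp only [pairPoly, map_ofNat]; norm_num
  | one => simp only [pairPoly, map_add, map_ofNat, Polynomial.aeval_X, pow_one, h3]
  | more j ih₀ ih₁ =>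
    simp only [pairPoly, map_sub, map_mul, map_add, map_ofNat, Polynomial.aeval_X, ih₀, ih₁, h3]
    linear_combination (2 * (2 * geom) ^ j + 2 * (1 - PowerSeries.X) ^ j) * geom_mul_one_sub

theorem weightedSubst_pairPoly (j : ℕ) :
    weightedSubst 3 (pairPoly j) =
      (2 : ℝ) ^ j • geom ^ (j + 1) + geom * (1 - PowerSeries.X) ^ j := by
  have h : (geom * (1 - PowerSeries.X)) ^ 2 = 1 := by rw [geom_mul_one_sub, one_pow]
  have e : (2 : ℝ) ^ j • geom ^ (j + 1) = 2 ^ j * geom ^ (j + 1) := by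
    rw [PowerSeries.smul_eq_C_mul, map_pow, map_ofNat]
  rw [weightedSubst_apply, aeval_pairPoly, e]
  linear_combination (geom * ((2 * geom) ^ j + (1 - PowerSeries.X) ^ j)) * h

theorem binom_natCast (N p : ℕ) : binom N p = N.choose p := by
  have h := descPochhammer_eval_eq_prod_range (R := ℝ) p N
  rw [descPochhammer_eval_eq_descFactorial] at h
  rw [binom, Int.cast_natCast, ← h, Nat.descFactorial_eq_factorial_mul_choose, Nat.cast_mul,
    mul_div_cancel_left₀ _ (by positivity)]

theorem binom_sub_succ (p k : ℕ) : binom ((p : ℤ) - (k + 1)) p = (-1) ^ p * k.choose p := by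
  rw [← binom_natCast, binom, binom, mul_div_assoc', ← Finset.prod_range_reflect,
    ← Finset.card_range p, ← Finset.prod_const, Finset.card_range, ← Finset.prod_mul_distrib]
  congr 1
  refine Finset.prod_congr rfl fun l hl => ?_
  have hl : l < p := Finset.mem_range.1 hl
  rw [Nat.cast_sub (by omega), Nat.cast_sub (by omega)]
  push_cast
  ring

theorem coeff_one_sub_X_pow (k p : ℕ) :
    PowerSeries.coeff p ((1 - PowerSeries.X) ^ k : PowerSeries ℝ) = (-1) ^ p * k.choose p := by
  induction k generalizing p with
  | zero => cases p <;> simp [PowerSeries.coeff_one]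
  | succ k ih =>
    rw [pow_succ', sub_mul, one_mul, map_sub, ih]
    cases p with
    | zero => simp
    | succ p =>
      rw [PowerSeries.coeff_succ_X_mul, ih, Nat.choose_succ_succ]
      push_cast
      ring

theorem coeff_geom_pow (j p : ℕ) :
    PowerSeries.coeff p (geom ^ (j + 1)) = (p + j).choose p := by
  rw [geom, PowerSeries.mk_one_pow_eq_mk_choose_add, PowerSeries.coeff_mk, add_comm,
    Nat.choose_symm_add]

theorem coeff_weightedSubst_pairPoly (i j : ℕ) :
    PowerSeries.coeff (2 * i) (weightedSubst 3 (pairPoly j)) =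
      (2 : ℝ) ^ j * binom (2 * (i : ℤ) + (j : ℤ)) (2 * i) +
        binom (2 * (i : ℤ) - (j : ℤ)) (2 * i) := by
  have h1 : binom (2 * (i : ℤ) + (j : ℤ)) (2 * i) = (2 * i + j).choose (2 * i) := by
    rw [← binom_natCast]; push_cast; rfl
  rw [weightedSubst_pairPoly, map_add, PowerSeries.coeff_smul, smul_eq_mul, coeff_geom_pow, h1]
  congr 1
  rcases j with _ | j
  · have h2 := binom_natCast (2 * i) (2 * i)
    push_cast at h2
    simp [h2, geom]
  · have h2 := binom_sub_succ (2 * i) j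
    push_cast at h2 ⊢
    rw [h2, pow_succ', ← mul_assoc, geom_mul_one_sub, one_mul, coeff_one_sub_X_pow]

theorem det_of_linearMap_polynomial {R : Type*} [CommRing R] {n : ℕ}
    (φ : Fin n → Polynomial R →ₗ[R] R) {f : ℕ → Polynomial R}
    (hf : ∀ j k, j < k → (f j).coeff k = 0) :
    (Matrix.of fun i j : Fin n => φ i (f j)).det =
      (Matrix.of fun i j : Fin n => φ i (Polynomial.X ^ (j : ℕ))).det *
        ∏ j ∈ Finset.range n, (f j).coeff j := by
  have hmul : (Matrix.of fun i j : Fin n => φ i (f j)) =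
      (Matrix.of fun i j : Fin n => φ i (Polynomial.X ^ (j : ℕ))) *
        Matrix.of fun k j : Fin n => (f j).coeff k := by
    ext i j
    have hdeg : (f j).natDegree < n :=
      (Polynomial.natDegree_le_iff_coeff_eq_zero.2 (hf j)).trans_lt j.isLt
    rw [Matrix.of_apply, Matrix.mul_apply]
    conv_lhs => rw [(f j).as_sum_range' n hdeg, map_sum, ← Fin.sum_univ_eq_sum_range
      (fun k => φ i (Polynomial.monomial k ((f j).coeff k)))]
    refine Finset.sum_congr rfl fun k _ => ?_
    rw [← Polynomial.smul_X_eq_monomial, map_smul, smul_eq_mul, mul_comm]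
    rfl
  have htri : (Matrix.of fun k j : Fin n => (f j).coeff k).IsUpperTriangular :=
    fun k j hkj => hf j k hkj
  rw [hmul, Matrix.det_mul, Matrix.det_of_isUpperTriangular htri,
    ← Fin.prod_univ_eq_prod_range fun j => (f j).coeff j]
  rfl

theorem det_weightedSubst_pairPoly (n : ℕ) :
    (Matrix.of fun i j : Fin (n + 1) =>
      PowerSeries.coeff (2 * (i : ℕ)) (weightedSubst 3 (pairPoly j))).det =
      2 * ∏ k ∈ Finset.range (n + 1), pivot k 2 := by
  let φ (i : Fin (n + 1)) : Polynomial ℝ →ₗ[ℝ] ℝ :=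
    PowerSeries.coeff (2 * (i : ℕ)) ∘ₗ weightedSubst 3
  have h1 := det_of_linearMap_polynomial φ pairPoly_coeff_of_lt
  have h2 := det_of_linearMap_polynomial φ fun j => orthPoly_coeff_of_lt j 2
  have htri : (Matrix.of fun i j : Fin (n + 1) => φ i (orthPoly j 2)).IsLowerTriangular :=
    fun i j hij => (evenLead_orthPoly j 2).1 i hij
  rw [Matrix.det_of_isLowerTriangular _ htri] at h2
  simp only [Finset.prod_range_succ', pairPoly_coeff_self, Finset.prod_const_one, one_mul] at h1
  simp only [orthPoly_coeff_self, Finset.prod_const_one, mul_one] at h2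
  have h3 : (pairPoly 0).coeff 0 = 2 := Polynomial.coeff_ofNat_zero 2
  have h4 : ∏ k : Fin (n + 1), φ k (orthPoly k 2) = ∏ k ∈ Finset.range (n + 1), pivot k 2 := by
    rw [← Fin.prod_univ_eq_prod_range fun k => pivot k 2]
    exact Finset.prod_congr rfl fun k _ => (evenLead_orthPoly k 2).2
  rw [← h4]
  change Matrix.det (Matrix.of fun i j : Fin (n + 1) => φ i (pairPoly j)) = _
  rw [h1, h3, ← h2, mul_comm]
  rfl

theorem prod_pivot_two_eq_Gamma (n : ℕ) :
    ∏ k ∈ Finset.range n, pivot k 2 = 2 ^ (n * (n - 1)) * ∏ i ∈ Finset.Icc 1 n,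
      (Real.Gamma (i : ℝ) * Real.Gamma (2 * (i : ℝ)) * Real.Gamma (4 * (i : ℝ) - 3) *
          Real.Gamma ((3 * (i : ℝ) - 1) / 2) /
        (Real.Gamma (2 * (i : ℝ) - 1) * Real.Gamma (3 * (i : ℝ) - 1) *
          Real.Gamma (3 * (i : ℝ) - 2) * Real.Gamma (((i : ℝ) + 1) / 2))) := by
  induction n with
  | zero => simp
  | succ n ih =>
    have e : (n + 1) * (n + 1 - 1) = n * (n - 1) + 2 * n := by
      cases n with
      | zero => rfl
      | succ m => simp only [Nat.add_sub_cancel]; ring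
    rw [Finset.prod_range_succ, ih, Finset.prod_Icc_succ_top (by omega), e, pow_add,
      pivot_two_eq_Gamma]
    push_cast
    ring

theorem stmt_2 (n : ℕ) (hn : 0 < n) :
    (Matrix.of fun i j : Fin n =>
        (2 : ℝ) ^ (j : ℕ) * binom (2 * ((i : ℕ) : ℤ) + ((j : ℕ) : ℤ)) (2 * (i : ℕ))
          + binom (2 * ((i : ℕ) : ℤ) - ((j : ℕ) : ℤ)) (2 * (i : ℕ))).det =
      2 * 2 ^ (n * (n - 1)) * ∏ i ∈ Finset.Icc 1 n,
          Real.Gamma (i : ℝ) * Real.Gamma (2 * (i : ℝ)) * Real.Gamma (4 * (i : ℝ) - 3) * Real.Gamma ((3 * (i : ℝ) - 1) / 2)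
            / (Real.Gamma (2 * (i : ℝ) - 1) * Real.Gamma (3 * (i : ℝ) - 1) * Real.Gamma (3 * (i : ℝ) - 2) * Real.Gamma (((i : ℝ) + 1) / 2)) := by
  obtain ⟨n, rfl⟩ : ∃ m, n = m + 1 := ⟨n - 1, by omega⟩
  simp only [← coeff_weightedSubst_pairPoly]
  rw [det_weightedSubst_pairPoly, prod_pivot_two_eq_Gamma, mul_assoc]
end
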